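/- arXiv:1203.4530 — 3 statements merged into one kernel-verified Lean document; each statement's English description precedes it below -/
import Mathlib

section
/- Let J be an infinite index set, A a unital C*-algebra, (a_j)_{j∈J} a CAR family over J in A, and (α_g)_{g∈ℙ_J} a family of *-algebra automorphisms of A implementing the finite permutations of J. Then every symmetric state φ on A is asymptotically Abelian in average: for all x, y, c, d ∈ A, the net indexed by the finite subsets I ⊆ J (ordered by inclusion) given by I ↦ (1/|ℙ_I|) Σ_{g∈ℙ_I} φ(c·(α_g(x)·y − y·α_g(x))·d) converges to 0. -/
open scoped ComplexOrder
open Filter Topology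

/-- A state on a unital C*-algebra: a linear functional with `φ 1 = 1` and `φ(x*x) ≥ 0`. -/
def IsState {A : Type*} [NormedRing A] [StarRing A] [CStarRing A] [NormedAlgebra ℂ A]
    [StarModule ℂ A] [CompleteSpace A] (φ : A →ₗ[ℂ] ℂ) : Prop :=
  φ 1 = 1 ∧ ∀ x : A, 0 ≤ φ (star x * x)

/-- A CAR family over `J` in `A`: a family satisfying the canonical anticommutation
relations and generating `A` as a closed *-subalgebra. -/
def IsCARFamily {J : Type*} {A : Type*} [NormedRing A] [StarRing A] [CStarRing A]
    [NormedAlgebra ℂ A] [StarModule ℂ A] [CompleteSpace A] (a : J → A) : Prop :=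
  (∀ j : J, star (a j) * a j + a j * star (a j) = 1) ∧
  (∀ j k : J, j ≠ k → star (a j) * a k + a k * star (a j) = 0) ∧
  (∀ j k : J, a j * a k + a k * a j = 0) ∧
  (StarAlgebra.adjoin ℂ (Set.range a)).topologicalClosure = ⊤

/-- A permutation moving only finitely many points. -/
def IsFinitePerm {J : Type*} (g : Equiv.Perm J) : Prop :=
  {j : J | g j ≠ j}.Finite

/-- The permutations of `J` fixing every point outside the finite set `I` form a
finite set. -/
theorem permsFixingOutside_finite {J : Type*} (I : Finset J) :
    {g : Equiv.Perm J | ∀ j ∉ I, g j = j}.Finite := by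
  classical
  have key : ∀ g ∈ {g : Equiv.Perm J | ∀ j ∉ I, g j = j}, ∀ i : J, i ∈ I → g i ∈ I := by
    intro g hg i hi
    by_contra hgi
    have h2 : g (g i) = g i := hg _ hgi
    have h3 : g i = i := g.injective h2
    rw [h3] at hgi
    exact hgi hi
  rw [← Set.finite_coe_iff]
  have hinj : Function.Injective
      (fun g : {g : Equiv.Perm J // ∀ j ∉ I, g j = j} =>
        (fun i : I => (⟨g.1 i, key g.1 g.2 i i.2⟩ : I))) := by
    intro g g' h
    apply Subtype.ext
    ext j
    by_cases hj : j ∈ I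
    · simpa [Subtype.ext_iff] using congrFun h ⟨j, hj⟩
    · rw [g.2 j hj, g'.2 j hj]
  exact Finite.of_injective _ hinj

/-- `ℙ_I`: the finite set of permutations of `J` fixing every point outside `I`. -/
noncomputable def permsOn {J : Type*} (I : Finset J) : Finset (Equiv.Perm J) :=
  (permsFixingOutside_finite I).toFinset

set_option linter.unusedSectionVars false

namespace CARAvg

/-- A letter: `a j` or its adjoint. -/
def letter {J A : Type*} [Star A] (a : J → A) (p : J × Bool) : A :=
  if p.2 then star (a p.1) else a p.1

/-- A word in the letters. -/
def word {J A : Type*} [Monoid A] [Star A] (a : J → A) (w : List (J × Bool)) : A :=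
  (w.map (letter a)).prod

/-- Permuting the indices of a word. -/
def mv {J : Type*} (g : J → J) (w : List (J × Bool)) : List (J × Bool) :=
  w.map (fun p => (g p.1, p.2))

section cstar
variable {A : Type*} [CStarAlgebra A]

lemma state_bound (φ : A →ₗ[ℂ] ℂ) (hφ : ∀ x : A, 0 ≤ φ (star x * x)) :
    ∃ C : ℝ, 0 ≤ C ∧ ∀ x, ‖φ x‖ ≤ C * ‖x‖ := by
  let _ := CStarAlgebra.spectralOrder A
  have _ := CStarAlgebra.spectralOrderedRing A
  have h0 : ∀ x : A, 0 ≤ x → 0 ≤ φ x := by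
    intro x hx
    rw [StarOrderedRing.nonneg_iff] at hx
    induction hx using AddSubmonoid.closure_induction with
    | mem x hx => obtain ⟨y, rfl⟩ := hx; exact hφ y
    | zero => simp
    | add x y _ _ h1 h2 => rw [map_add]; exact add_nonneg h1 h2
  obtain ⟨C, hC⟩ := PositiveLinearMap.exists_norm_apply_le (PositiveLinearMap.mk₀ φ h0)
  exact ⟨C, C.2, hC⟩

lemma norm_sq_le (x : A) : ‖x‖ ^ 2 ≤ ‖x * star x + star x * x‖ := by
  let _ := CStarAlgebra.spectralOrder A
  have _ := CStarAlgebra.spectralOrderedRing A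
  rw [sq, ← CStarRing.norm_star_mul_self]
  exact CStarAlgebra.norm_le_norm_of_nonneg_of_le (star_mul_self_nonneg x)
    (le_add_of_nonneg_left (mul_star_self_nonneg x))

lemma norm_equiv (f : A ≃⋆ₐ[ℂ] A) (x : A) : ‖f x‖ = ‖x‖ :=
  NonUnitalStarAlgHom.norm_map f f.injective x

end cstar

section perms
variable {J : Type*}

lemma mem_permsOn {I : Finset J} {g : Equiv.Perm J} : g ∈ permsOn I ↔ ∀ j ∉ I, g j = j := by
  simp [permsOn]

lemma permsOn_pos (I : Finset J) : 0 < (permsOn I).card :=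
  Finset.card_pos.2 ⟨1, mem_permsOn.2 fun _ _ => rfl⟩

lemma permsOn_fin {I : Finset J} {g : Equiv.Perm J} (hg : g ∈ permsOn I) : IsFinitePerm g := by
  refine I.finite_toSet.subset fun j hj => ?_
  by_contra h
  exact hj (mem_permsOn.1 hg j h)

lemma permsOn_mem {I : Finset J} {g : Equiv.Perm J} (hg : g ∈ permsOn I) {i : J} (hi : i ∈ I) :
    g i ∈ I := by
  by_contra h
  have := g.injective (mem_permsOn.1 hg _ h)
  rw [this] at h
  exact h hi

open Classical in
lemma count (I : Finset J) {i : J} (hi : i ∈ I) (j : J) :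
    ((permsOn I).filter (fun g => g i = j)).card * I.card ≤ (permsOn I).card := by
  by_cases hj : j ∈ I
  · have h1 : (permsOn I).card = ∑ k ∈ I, ((permsOn I).filter (fun g => g i = k)).card :=
      Finset.card_eq_sum_card_fiberwise (fun g hg => permsOn_mem hg hi)
    rw [h1, mul_comm, ← smul_eq_mul]
    refine Finset.card_nsmul_le_sum _ _ _ fun k hk => ?_
    refine Finset.card_le_card_of_injOn (fun g => Equiv.swap j k * g) ?_ ?_
    · intro g hg
      simp only [Finset.coe_filter, Set.mem_ofPred_eq] at hg ⊢
      refine ⟨mem_permsOn.2 fun l hl => ?_, by simp [hg.2]⟩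
      rw [Equiv.Perm.mul_apply, mem_permsOn.1 hg.1 l hl]
      exact Equiv.swap_apply_of_ne_of_ne (by rintro rfl; exact hl hj) (by rintro rfl; exact hl hk)
    · intro g _ h _ hgh
      exact mul_left_cancel hgh
  · rw [Finset.filter_false_of_mem]
    · simp
    · rintro g hg rfl
      exact hj (permsOn_mem hg hi)

open Classical in
lemma count2 (I S T : Finset J) (hS : S ⊆ I) :
    ((permsOn I).filter (fun g => ∃ i ∈ S, g i ∈ T)).card * I.card
      ≤ S.card * T.card * (permsOn I).card := by
  have h : (permsOn I).filter (fun g => ∃ i ∈ S, g i ∈ T) ⊆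
      (S ×ˢ T).biUnion (fun p => (permsOn I).filter (fun g => g p.1 = p.2)) := by
    intro g hg
    simp only [Finset.mem_filter] at hg
    obtain ⟨hg, i, hi, hT⟩ := hg
    simp only [Finset.mem_biUnion, Finset.mem_filter]
    exact ⟨(i, g i), Finset.mem_product.2 ⟨hi, hT⟩, hg, rfl⟩
  calc _ ≤ (∑ p ∈ S ×ˢ T, ((permsOn I).filter (fun g => g p.1 = p.2)).card) * I.card :=
        Nat.mul_le_mul_right _ ((Finset.card_le_card h).trans Finset.card_biUnion_le)
    _ = ∑ p ∈ S ×ˢ T, ((permsOn I).filter (fun g => g p.1 = p.2)).card * I.card :=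
        Finset.sum_mul ..
    _ ≤ (S ×ˢ T).card • (permsOn I).card :=
        Finset.sum_le_card_nsmul _ _ _ fun p hp => count I (hS (Finset.mem_product.1 hp).1) _
    _ = _ := by rw [Finset.card_product, smul_eq_mul]

lemma inv_card_tendsto [Infinite J] (C : ℝ) :
    Tendsto (fun I : Finset J => C / (I.card : ℝ)) atTop (𝓝 0) := by
  refine Tendsto.div_atTop tendsto_const_nhds (tendsto_natCast_atTop_atTop.comp ?_)
  refine tendsto_atTop_atTop.2 fun n => ?_
  obtain ⟨s, hs⟩ := Infinite.exists_subset_card_eq J n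
  exact ⟨s, fun t ht => hs ▸ Finset.card_le_card ht⟩

end perms

section words
variable {J : Type*} {A : Type*} [NormedRing A] [StarRing A] [CStarRing A] [NormedAlgebra ℂ A]
    [StarModule ℂ A] [CompleteSpace A]

lemma letter_comm {a : J → A} (ha : IsCARFamily a) {p q : J × Bool} (h : p.1 ≠ q.1) :
    letter a p * letter a q = (-1 : ℂ) • (letter a q * letter a p) := by
  obtain ⟨-, h2, h3, -⟩ := ha
  obtain ⟨j, b⟩ := p
  obtain ⟨k, b'⟩ := q
  simp only at h
  rw [neg_one_smul]
  refine eq_neg_of_add_eq_zero_left ?_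
  cases b <;> cases b' <;> simp only [letter, if_true, if_false, Bool.false_eq_true]
  · exact h3 j k
  · rw [add_comm]; exact h2 k j h.symm
  · exact h2 j k h
  · have := congrArg star (h3 k j)
    simpa using this

lemma letter_word {a : J → A} (ha : IsCARFamily a) (p : J × Bool) (v : List (J × Bool))
    (h : ∀ q ∈ v, p.1 ≠ q.1) :
    letter a p * word a v = (-1 : ℂ) ^ v.length • (word a v * letter a p) := by
  induction v with
  | nil => simp [word]
  | cons q v ih =>
    have ih := ih fun r hr => h r (List.mem_cons_of_mem _ hr)
    have e : word a (q :: v) = letter a q * word a v := by simp [word]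
    rw [e, ← mul_assoc, letter_comm ha (h q List.mem_cons_self), smul_mul_assoc, mul_assoc, ih,
      mul_smul_comm, smul_smul, List.length_cons, pow_succ', mul_assoc]

lemma word_word {a : J → A} (ha : IsCARFamily a) (w v : List (J × Bool))
    (h : ∀ p ∈ w, ∀ q ∈ v, p.1 ≠ q.1) :
    word a w * word a v = (-1 : ℂ) ^ (w.length * v.length) • (word a v * word a w) := by
  induction w with
  | nil => simp [word]
  | cons q w ih =>
    have ih := ih fun r hr => h r (List.mem_cons_of_mem _ hr)
    have e : word a (q :: w) = letter a q * word a w := by simp [word]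
    rw [e, mul_assoc, ih, mul_smul_comm, ← mul_assoc, letter_word ha q v (h q List.mem_cons_self),
      smul_mul_assoc, smul_smul, List.length_cons, ← pow_add, mul_assoc]
    congr 2
    ring

lemma star_letter (a : J → A) (p : J × Bool) : star (letter a p) = letter a (p.1, !p.2) := by
  obtain ⟨j, b⟩ := p
  cases b <;> simp [letter]

/-- The adjoint word. -/
def adj (w : List (J × Bool)) : List (J × Bool) := (w.map fun p => (p.1, !p.2)).reverse

lemma star_word (a : J → A) (w : List (J × Bool)) : star (word a w) = word a (adj w) := by
  induction w with
  | nil => simp [word, adj]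
  | cons q w ih =>
    have e : word a (q :: w) = letter a q * word a w := by simp [word]
    rw [e, star_mul, ih, star_letter]
    simp [word, adj]

lemma map_word {a : J → A} {g : Equiv.Perm J} (f : A ≃⋆ₐ[ℂ] A) (hf : ∀ j, f (a j) = a (g j))
    (w : List (J × Bool)) : f (word a w) = word a (mv g w) := by
  induction w with
  | nil => simp [word, mv]
  | cons q w ih =>
    have e : ∀ q w, word a (q :: w) = letter a q * word a w := by intros; simp [word]
    have e2 : mv g (q :: w) = (g q.1, q.2) :: mv g w := rfl
    rw [e2, e, e, map_mul, ih]
    congr 1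
    obtain ⟨j, b⟩ := q
    cases b <;> simp [letter, hf, map_star]

/-- Word support. -/
noncomputable def supp (w : List (J × Bool)) : Finset J := by
  classical exact (w.map Prod.fst).toFinset

lemma mem_supp {w : List (J × Bool)} {p : J × Bool} (h : p ∈ w) : p.1 ∈ supp w := by
  classical
  simp only [supp, List.mem_toFinset, List.mem_map]
  exact ⟨p, h, rfl⟩

lemma supp_card (w : List (J × Bool)) : (supp w).card ≤ w.length := by
  classical
  simpa [supp] using List.toFinset_card_le (w.map Prod.fst)

lemma dense_words {a : J → A} (ha : IsCARFamily a) :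
    Dense ((Submodule.span ℂ (Set.range (word a)) : Submodule ℂ A) : Set A) := by
  have h4 := ha.2.2.2
  have h : ((StarAlgebra.adjoin ℂ (Set.range a) : StarSubalgebra ℂ A) : Set A) ⊆
      (Submodule.span ℂ (Set.range (word a)) : Submodule ℂ A) := by
    intro x hx
    have hx' : x ∈ Subalgebra.toSubmodule (StarAlgebra.adjoin ℂ (Set.range a)).toSubalgebra := hx
    rw [StarAlgebra.adjoin_eq_span] at hx'
    refine Submodule.span_mono ?_ hx'
    intro z hz
    induction hz using Submonoid.closure_induction with
    | mem z hz =>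
      rcases hz with ⟨j, rfl⟩ | hz
      · exact ⟨[(j, false)], by simp [word, letter]⟩
      · obtain ⟨j, hj⟩ := hz
        exact ⟨[(j, true)], by simp [word, letter, hj]⟩
    | one => exact ⟨[], by simp [word]⟩
    | mul x y _ _ hx hy =>
      obtain ⟨w, rfl⟩ := hx
      obtain ⟨v, rfl⟩ := hy
      exact ⟨w ++ v, by simp [word]⟩
  refine Dense.mono h ?_
  rw [dense_iff_closure_eq, ← StarSubalgebra.topologicalClosure_coe, h4]
  rfl

/-- Density principle. -/
lemma density {ι : Type*} {l : Filter ι} (L : ι → A →ₗ[ℂ] A) (C : ℝ) (hC : ∀ i x, ‖L i x‖ ≤ C * ‖x‖)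
    {S : Set A} (hS : Dense ((Submodule.span ℂ S : Submodule ℂ A) : Set A))
    (h : ∀ x ∈ S, Tendsto (fun i => L i x) l (𝓝 0)) (x : A) :
    Tendsto (fun i => L i x) l (𝓝 0) := by
  have h1 : ∀ x ∈ Submodule.span ℂ S, Tendsto (fun i => L i x) l (𝓝 0) := by
    intro x hx
    induction hx using Submodule.span_induction with
    | mem x hx => exact h x hx
    | zero => simpa using tendsto_const_nhds
    | add x y _ _ h1 h2 => simpa using h1.add h2
    | smul c x _ h1 => simpa using h1.const_smul c
  rw [Metric.tendsto_nhds]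
  intro ε hε
  obtain ⟨y, hy, hxy⟩ := Metric.dense_iff.1 hS x (ε / 2 / (|C| + 1)) (by positivity)
  have hy' : ‖x - y‖ < ε / 2 / (|C| + 1) := by
    rw [← dist_eq_norm, dist_comm]; exact hy
  filter_upwards [Metric.tendsto_nhds.1 (h1 y hxy) (ε / 2) (by positivity)] with i hi
  rw [dist_zero_right] at hi ⊢
  have e : L i x = L i (x - y) + L i y := by simp
  have h2 : ‖L i (x - y)‖ ≤ ε / 2 := by
    refine (hC i _).trans ?_
    rw [lt_div_iff₀ (by positivity)] at hy'
    nlinarith [le_abs_self C, norm_nonneg (x - y)]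
  rw [e]
  linarith [norm_add_le (L i (x - y)) (L i y)]

end words

section main
variable {J : Type*} {A : Type*} [NormedRing A] [StarRing A] [CStarRing A] [NormedAlgebra ℂ A]
    [StarModule ℂ A] [CompleteSpace A]

lemma avg_bound {a : J → A} (ha : IsCARFamily a) (α : Equiv.Perm J → (A ≃⋆ₐ[ℂ] A))
    (hα : ∀ g : Equiv.Perm J, IsFinitePerm g → ∀ j : J, α g (a j) = a (g j))
    (hn : ∀ g x, ‖α g x‖ = ‖x‖) (w v : List (J × Bool)) (I : Finset J) (hI : supp w ⊆ I) :
    ‖∑ g ∈ permsOn I, (α g (word a w) * word a v -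
      (-1 : ℂ) ^ (w.length * v.length) • (word a v * α g (word a w)))‖ * I.card
      ≤ w.length * v.length * (2 * ‖word a w‖ * ‖word a v‖) * (permsOn I).card := by
  classical
  set B : ℝ := 2 * ‖word a w‖ * ‖word a v‖ with hB
  have hB0 : 0 ≤ B := by positivity
  set bad := (permsOn I).filter (fun g => ∃ i ∈ supp w, g i ∈ supp v) with hbad
  have h1 : ‖∑ g ∈ permsOn I, (α g (word a w) * word a v -
      (-1 : ℂ) ^ (w.length * v.length) • (word a v * α g (word a w)))‖ ≤ bad.card * B := by
    rw [← Finset.sum_filter_add_sum_filter_not (permsOn I)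
      (fun g => ∃ i ∈ supp w, g i ∈ supp v)]
    rw [Finset.sum_eq_zero (s := (permsOn I).filter fun g => ¬ ∃ i ∈ supp w, g i ∈ supp v),
      add_zero]
    · rw [← nsmul_eq_mul]
      refine (norm_sum_le _ _).trans (Finset.sum_le_card_nsmul _ _ _ fun g _ => ?_)
      refine (norm_sub_le _ _).trans ?_
      have e1 := norm_mul_le (α g (word a w)) (word a v)
      have e2 := norm_mul_le (word a v) (α g (word a w))
      rw [hn] at e1 e2
      rw [norm_smul, norm_pow, norm_neg, norm_one, one_pow, one_mul, hB]
      linarith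
    · intro g hg
      rw [Finset.mem_filter] at hg
      rw [map_word (α g) (hα g (permsOn_fin hg.1)), sub_eq_zero]
      have := word_word ha (mv g w) v ?_
      · rw [this]; simp [mv]
      · intro p hp q hq hpq
        simp only [mv, List.mem_map] at hp
        obtain ⟨r, hr, rfl⟩ := hp
        refine hg.2 ⟨r.1, mem_supp hr, ?_⟩
        simp only at hpq
        rw [hpq]
        exact mem_supp hq
  have h2 : (bad.card : ℝ) * I.card ≤ w.length * v.length * (permsOn I).card := by
    have := count2 I (supp w) (supp v) hI
    have h3 : bad.card * I.card ≤ w.length * v.length * (permsOn I).card :=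
      this.trans (Nat.mul_le_mul_right _ (Nat.mul_le_mul (supp_card w) (supp_card v)))
    exact_mod_cast h3
  calc _ ≤ bad.card * B * I.card := by gcongr
    _ = bad.card * I.card * B := by ring
    _ ≤ w.length * v.length * (permsOn I).card * B := by gcongr
    _ = _ := by ring

/-- The averaging operator. -/
noncomputable def avg (α : Equiv.Perm J → (A ≃⋆ₐ[ℂ] A)) (I : Finset J) : A →ₗ[ℂ] A :=
  ((permsOn I).card : ℂ)⁻¹ • ∑ g ∈ permsOn I, (α g).toAlgEquiv.toLinearMap

lemma avg_apply (α : Equiv.Perm J → (A ≃⋆ₐ[ℂ] A)) (I : Finset J) (x : A) :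
    avg α I x = ((permsOn I).card : ℂ)⁻¹ • ∑ g ∈ permsOn I, α g x := by
  simp [avg, LinearMap.sum_apply]

lemma card_pos' (I : Finset J) : (0 : ℝ) < (permsOn I).card := by
  exact_mod_cast permsOn_pos I

lemma norm_avg (α : Equiv.Perm J → (A ≃⋆ₐ[ℂ] A)) (hn : ∀ g x, ‖α g x‖ = ‖x‖)
    (I : Finset J) (x : A) : ‖avg α I x‖ ≤ ‖x‖ := by
  rw [avg_apply, norm_smul, norm_inv, Complex.norm_natCast, inv_mul_le_iff₀ (card_pos' I),
    ← nsmul_eq_mul]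
  exact (norm_sum_le _ _).trans (Finset.sum_le_card_nsmul _ _ _ fun g _ => (hn g x).le)

lemma avg_bound' [Infinite J] {a : J → A} (ha : IsCARFamily a) (α : Equiv.Perm J → (A ≃⋆ₐ[ℂ] A))
    (hα : ∀ g : Equiv.Perm J, IsFinitePerm g → ∀ j : J, α g (a j) = a (g j))
    (hn : ∀ g x, ‖α g x‖ = ‖x‖) (w v : List (J × Bool)) (I : Finset J) (hI : supp w ⊆ I)
    (hc : 0 < I.card) :
    ‖avg α I (word a w) * word a v -
      (-1 : ℂ) ^ (w.length * v.length) • (word a v * avg α I (word a w))‖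
      ≤ w.length * v.length * (2 * ‖word a w‖ * ‖word a v‖) / I.card := by
  have h := avg_bound ha α hα hn w v I hI
  have e : avg α I (word a w) * word a v -
      (-1 : ℂ) ^ (w.length * v.length) • (word a v * avg α I (word a w)) =
      ((permsOn I).card : ℂ)⁻¹ • ∑ g ∈ permsOn I, (α g (word a w) * word a v -
      (-1 : ℂ) ^ (w.length * v.length) • (word a v * α g (word a w))) := by
    rw [avg_apply, Finset.sum_sub_distrib, ← Finset.smul_sum, ← Finset.mul_sum, ← Finset.sum_mul,
      smul_sub, smul_mul_assoc, mul_smul_comm, smul_comm]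
  have hc' : (0 : ℝ) < I.card := by exact_mod_cast hc
  rw [e, norm_smul, norm_inv, Complex.norm_natCast, inv_mul_le_iff₀ (card_pos' I), mul_div_assoc',
    le_div_iff₀ hc']
  linarith

lemma odd_avg [Infinite J] {a : J → A} (ha : IsCARFamily a) (α : Equiv.Perm J → (A ≃⋆ₐ[ℂ] A))
    (hα : ∀ g : Equiv.Perm J, IsFinitePerm g → ∀ j : J, α g (a j) = a (g j))
    (hn : ∀ g x, ‖α g x‖ = ‖x‖) (hsq : ∀ x : A, ‖x‖ ^ 2 ≤ ‖x * star x + star x * x‖)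
    (w : List (J × Bool)) (hw : Odd w.length) :
    Tendsto (fun I => avg α I (word a w)) atTop (𝓝 0) := by
  set D : ℝ := w.length * w.length * (2 * ‖word a w‖ * ‖word a w‖) with hD
  have key : ∀ I : Finset J, supp w ⊆ I → 0 < I.card → ‖avg α I (word a w)‖ ^ 2 ≤ D / I.card := by
    intro I hI hc
    refine (hsq _).trans ?_
    set X := avg α I (word a w) with hX
    have e : X * star X + star X * X = ((permsOn I).card : ℂ)⁻¹ • ∑ h ∈ permsOn I,
        (X * word a (adj (mv h w)) - (-1 : ℂ) ^ (w.length * (adj (mv h w)).length) •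
          (word a (adj (mv h w)) * X)) := by
      have hs : star X = ((permsOn I).card : ℂ)⁻¹ • ∑ h ∈ permsOn I, word a (adj (mv h w)) := by
        rw [hX, avg_apply, star_smul, star_sum]
        congr 1
        · simp
        · refine Finset.sum_congr rfl fun h hh => ?_
          rw [map_word (α h) (hα h (permsOn_fin hh)), star_word]
      have hl : ∀ h : Equiv.Perm J, (-1 : ℂ) ^ (w.length * (adj (mv h w)).length) = -1 := by
        intro h
        have : (adj (mv h w)).length = w.length := by simp [adj, mv]
        rw [this]
        exact (hw.mul hw).neg_one_pow
      simp only [hl, neg_one_smul, sub_neg_eq_add]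
      rw [Finset.sum_add_distrib, ← Finset.mul_sum, ← Finset.sum_mul, hs, mul_smul_comm,
        smul_mul_assoc, smul_add]
    rw [e, norm_smul, norm_inv, Complex.norm_natCast, inv_mul_le_iff₀ (card_pos' I),
      ← nsmul_eq_mul]
    refine (norm_sum_le _ _).trans (Finset.sum_le_card_nsmul _ _ _ fun h hh => ?_)
    refine (avg_bound' ha α hα hn w (adj (mv h w)) I hI hc).trans (le_of_eq ?_)
    have h1 : (adj (mv h w)).length = w.length := by simp [adj, mv]
    have h2 : ‖word a (adj (mv h w))‖ = ‖word a w‖ := by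
      rw [← star_word, norm_star, ← map_word (α h) (hα h (permsOn_fin hh)), hn]
    rw [h1, h2, hD]
  have h0 : Tendsto (fun I => ‖avg α I (word a w)‖ ^ 2) atTop (𝓝 0) := by
    refine squeeze_zero' (.of_forall fun _ => by positivity) ?_ (inv_card_tendsto (J := J) D)
    obtain ⟨j⟩ : Nonempty J := inferInstance
    filter_upwards [eventually_ge_atTop (supp w), eventually_ge_atTop {j}] with I hI hj
    exact key I hI (Finset.card_pos.2 ⟨j, hj (by simp)⟩)
  rw [tendsto_zero_iff_norm_tendsto_zero]
  have := (Real.continuous_sqrt.tendsto 0).comp h0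
  simpa [Function.comp_def, Real.sqrt_sq] using this

lemma word_case [Infinite J] {a : J → A} (ha : IsCARFamily a) (α : Equiv.Perm J → (A ≃⋆ₐ[ℂ] A))
    (hα : ∀ g : Equiv.Perm J, IsFinitePerm g → ∀ j : J, α g (a j) = a (g j))
    (hn : ∀ g x, ‖α g x‖ = ‖x‖) (hsq : ∀ x : A, ‖x‖ ^ 2 ≤ ‖x * star x + star x * x‖)
    (w v : List (J × Bool)) :
    Tendsto (fun I => avg α I (word a w) * word a v - word a v * avg α I (word a w))
      atTop (𝓝 0) := by
  rcases Nat.even_or_odd w.length with hw | hw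
  · refine squeeze_zero_norm' ?_ (inv_card_tendsto (J := J)
      (w.length * v.length * (2 * ‖word a w‖ * ‖word a v‖)))
    obtain ⟨j⟩ : Nonempty J := inferInstance
    filter_upwards [eventually_ge_atTop (supp w), eventually_ge_atTop {j}] with I hI hj
    have := avg_bound' ha α hα hn w v I hI (Finset.card_pos.2 ⟨j, hj (by simp)⟩)
    rwa [(hw.mul_right v.length).neg_one_pow, one_smul] at this
  · have h := odd_avg ha α hα hn hsq w hw
    simpa using (h.mul_const (word a v)).sub (h.const_mul (word a v))

lemma full_case [Infinite J] {a : J → A} (ha : IsCARFamily a) (α : Equiv.Perm J → (A ≃⋆ₐ[ℂ] A))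
    (hα : ∀ g : Equiv.Perm J, IsFinitePerm g → ∀ j : J, α g (a j) = a (g j))
    (hn : ∀ g x, ‖α g x‖ = ‖x‖) (hsq : ∀ x : A, ‖x‖ ^ 2 ≤ ‖x * star x + star x * x‖)
    (x y : A) :
    Tendsto (fun I => avg α I x * y - y * avg α I x) atTop (𝓝 0) := by
  have hb : ∀ I x y, ‖avg α I x * y - y * avg α I x‖ ≤ 2 * ‖x‖ * ‖y‖ := by
    intro I x y
    refine (norm_sub_le _ _).trans ?_
    have e1 := norm_mul_le (avg α I x) y
    have e2 := norm_mul_le y (avg α I x)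
    have e3 := mul_le_mul_of_nonneg_right (norm_avg α hn I x) (norm_nonneg y)
    linarith
  refine density (fun I => LinearMap.mulLeft ℂ (avg α I x) - LinearMap.mulRight ℂ (avg α I x))
    (2 * ‖x‖) (fun I y => by simpa using hb I x y) (dense_words ha) ?_ y
  rintro _ ⟨v, rfl⟩
  refine density (fun I => (LinearMap.mulRight ℂ (word a v) - LinearMap.mulLeft ℂ (word a v)) ∘ₗ
    avg α I) (2 * ‖word a v‖) (fun I y => ?_) (dense_words ha) ?_ x
  · have := hb I y (word a v)
    simp only [LinearMap.comp_apply, LinearMap.sub_apply, LinearMap.mulRight_apply,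
      LinearMap.mulLeft_apply]
    linarith
  · rintro _ ⟨w, rfl⟩
    exact word_case ha α hα hn hsq w v

end main

end CARAvg


/-- Every symmetric state on the CAR algebra over an infinite index set `J` is
asymptotically Abelian in average: for all `x, y, c, d`, the net (over finite `I ⊆ J`)
of averages `(1/|ℙ_I|) Σ_{g ∈ ℙ_I} φ(c·[α_g(x), y]·d)` converges to `0`. -/
theorem symmetric_state_asymptotically_abelian_in_average {J : Type*} [Infinite J]
    {A : Type*} [NormedRing A] [StarRing A] [CStarRing A] [NormedAlgebra ℂ A]
    [StarModule ℂ A] [CompleteSpace A]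
    (a : J → A) (ha : IsCARFamily a)
    (α : Equiv.Perm J → (A ≃⋆ₐ[ℂ] A))
    (hα : ∀ g : Equiv.Perm J, IsFinitePerm g → ∀ j : J, α g (a j) = a (g j))
    (φ : A →ₗ[ℂ] ℂ) (hφ : IsState φ)
    (hsym : ∀ g : Equiv.Perm J, IsFinitePerm g → ∀ x : A, φ (α g x) = φ x)
    (x y c d : A) :
    Tendsto
      (fun I : Finset J => ((permsOn I).card : ℂ)⁻¹ *
        ∑ g ∈ permsOn I, φ (c * (α g x * y - y * α g x) * d))
      atTop (𝓝 0) := by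
  letI : CStarAlgebra A := {}
  obtain ⟨C, hC0, hC⟩ := CARAvg.state_bound φ hφ.2
  have h := CARAvg.full_case ha α hα (fun g x => CARAvg.norm_equiv (α g) x)
    (fun x => CARAvg.norm_sq_le x) x y
  have h2 := (h.const_mul c).mul_const d
  rw [mul_zero, zero_mul, tendsto_zero_iff_norm_tendsto_zero] at h2
  have h3 := h2.const_mul C
  rw [mul_zero] at h3
  refine squeeze_zero_norm (fun I => ?_) h3
  refine le_trans (le_of_eq ?_) (hC _)
  rw [CARAvg.avg_apply, smul_mul_assoc, mul_smul_comm, ← smul_sub, mul_smul_comm, smul_mul_assoc,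
    map_smul, smul_eq_mul, ← map_sum, ← Finset.sum_mul, ← Finset.mul_sum, Finset.sum_sub_distrib,
    ← Finset.sum_mul, ← Finset.mul_sum]
end

section
/- Let J be an infinite index set, A a unital C*-algebra, (a_j)_{j∈J} a CAR family over J in A, and (α_g)_{g∈ℙ_J} a family of *-algebra automorphisms of A implementing the finite permutations of J. A symmetric state φ on A is an extreme point of the convex set of symmetric states if and only if φ is weakly clustering: for all x, y ∈ A, the net indexed by the finite subsets I ⊆ J (ordered by inclusion) given by I ↦ (1/|ℙ_I|) Σ_{g∈ℙ_I} φ(α_g(x)·y) converges to φ(x)·φ(y). -/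
open scoped ComplexOrder
open Filter Topology

/-- The convex set of symmetric states: states invariant under all the automorphisms
implementing finite permutations. -/
def SymmetricStates {J : Type*} {A : Type*} [NormedRing A] [StarRing A] [CStarRing A]
    [NormedAlgebra ℂ A] [StarModule ℂ A] [CompleteSpace A]
    (α : Equiv.Perm J → (A ≃⋆ₐ[ℂ] A)) : Set (A →ₗ[ℂ] ℂ) :=
  {ψ | IsState ψ ∧ ∀ g : Equiv.Perm J, IsFinitePerm g → ∀ x : A, ψ (α g x) = ψ x}


section CARAux

variable {A : Type*} [CStarAlgebra A]

/-- A state is bundled as a positive map for the spectral order. -/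
theorem IsState.exists_pos {φ : A →ₗ[ℂ] ℂ} (h : IsState φ) :
    letI := CStarAlgebra.spectralOrder A
    ∃ f : A →ₚ[ℂ] ℂ, ∀ x, f x = φ x := by
  letI := CStarAlgebra.spectralOrder A
  haveI := CStarAlgebra.spectralOrderedRing A
  refine ⟨PositiveLinearMap.mk₀ φ ?_, fun x => rfl⟩
  intro x hx
  obtain ⟨s, rfl⟩ := CStarAlgebra.nonneg_iff_eq_star_mul_self.mp hx
  exact h.2 s

theorem IsState.bound {φ : A →ₗ[ℂ] ℂ} (h : IsState φ) :
    ∃ C : ℝ, 0 ≤ C ∧ ∀ x, ‖φ x‖ ≤ C * ‖x‖ := by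
  letI := CStarAlgebra.spectralOrder A
  haveI := CStarAlgebra.spectralOrderedRing A
  obtain ⟨f, hf⟩ := h.exists_pos
  obtain ⟨C, hC⟩ := f.exists_norm_apply_le
  exact ⟨C, C.2, fun x => hf x ▸ hC x⟩

theorem IsState.map_star' {φ : A →ₗ[ℂ] ℂ} (h : IsState φ) (x : A) :
    φ (star x) = star (φ x) := by
  letI := CStarAlgebra.spectralOrder A
  haveI := CStarAlgebra.spectralOrderedRing A
  obtain ⟨f, hf⟩ := h.exists_pos
  rw [← hf, ← hf, map_star]

theorem IsState.cs {φ : A →ₗ[ℂ] ℂ} (h : IsState φ) (x : A) :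
    ‖φ x‖ ^ 2 ≤ (φ (star x * x)).re := by
  letI := CStarAlgebra.spectralOrder A
  haveI := CStarAlgebra.spectralOrderedRing A
  obtain ⟨f, hf⟩ := h.exists_pos
  have h1 := norm_inner_le_norm (𝕜 := ℂ) (f.toPreGNS 1) (f.toPreGNS x)
  rw [f.preGNS_inner_def, f.preGNS_norm_def, f.preGNS_norm_def] at h1
  simp only [f.ofPreGNS_toPreGNS, star_one, one_mul, hf, h.1, Complex.one_re, Real.sqrt_one] at h1
  have h2 : 0 ≤ (φ (star x * x)).re := (Complex.nonneg_iff.mp (h.2 x)).1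
  calc ‖φ x‖ ^ 2 ≤ (√(φ (star x * x)).re) ^ 2 := by gcongr
    _ = _ := Real.sq_sqrt h2

theorem IsState.conj_le {φ : A →ₗ[ℂ] ℂ} (h : IsState φ) (w y : A) :
    (φ (star (w * y) * (w * y))).re ≤ ‖w‖ ^ 2 * (φ (star y * y)).re := by
  letI := CStarAlgebra.spectralOrder A
  haveI := CStarAlgebra.spectralOrderedRing A
  obtain ⟨f, hf⟩ := h.exists_pos
  have h1 := (f.leftMulMapPreGNS w).le_of_opNorm_le (c := ‖w‖)
    (LinearMap.mkContinuous_norm_le _ (norm_nonneg _) _) (f.toPreGNS y)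
  have h2 : ‖f.leftMulMapPreGNS w (f.toPreGNS y)‖ ^ 2 ≤ (‖w‖ * ‖f.toPreGNS y‖) ^ 2 := by gcongr
  have h3 := f.preGNS_norm_sq (f.leftMulMapPreGNS w (f.toPreGNS y))
  have h4 := f.preGNS_norm_sq (f.toPreGNS y)
  simp only [PositiveLinearMap.leftMulMapPreGNS_apply, f.ofPreGNS_toPreGNS, hf] at h3 h4
  rw [mul_pow] at h2
  rw [← h3, ← h4]
  norm_cast

/-- `‖x‖² ≤ ‖x* x + x x*‖` -/
theorem norm_sq_le_anticomm (x : A) : ‖x‖ ^ 2 ≤ ‖star x * x + x * star x‖ := by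
  letI := CStarAlgebra.spectralOrder A
  haveI := CStarAlgebra.spectralOrderedRing A
  rw [sq, ← CStarRing.norm_star_mul_self]
  exact CStarAlgebra.norm_le_norm_of_nonneg_of_le (star_mul_self_nonneg x)
    (le_add_of_nonneg_right (mul_star_self_nonneg x))

theorem starAlgEquiv_norm (e : A ≃⋆ₐ[ℂ] A) (x : A) : ‖e x‖ = ‖x‖ := by
  exact NonUnitalStarAlgHom.norm_map e e.injective x


section perms
variable {J : Type*}

theorem mem_permsOn {I : Finset J} {g : Equiv.Perm J} :
    g ∈ permsOn I ↔ ∀ j ∉ I, g j = j := by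
  simp [permsOn]

theorem one_mem_permsOn (I : Finset J) : (1 : Equiv.Perm J) ∈ permsOn I := by
  simp [mem_permsOn]

theorem mul_mem_permsOn {I : Finset J} {g h : Equiv.Perm J} (hg : g ∈ permsOn I)
    (hh : h ∈ permsOn I) : g * h ∈ permsOn I := by
  rw [mem_permsOn] at *
  intro j hj
  simp [hh j hj, hg j hj]

theorem inv_mem_permsOn {I : Finset J} {g : Equiv.Perm J} (hg : g ∈ permsOn I) :
    g⁻¹ ∈ permsOn I := by
  rw [mem_permsOn] at *
  intro j hj
  rw [Equiv.Perm.inv_eq_iff_eq, hg j hj]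

theorem permsOn_isFinite {I : Finset J} {g : Equiv.Perm J} (hg : g ∈ permsOn I) :
    IsFinitePerm g := by
  rw [mem_permsOn] at hg
  refine I.finite_toSet.subset ?_
  intro j hj
  by_contra h
  exact hj (hg j h)

theorem card_permsOn_pos (I : Finset J) : 0 < (permsOn I).card :=
  Finset.card_pos.mpr ⟨1, one_mem_permsOn I⟩

theorem eventually_mem_permsOn {g : Equiv.Perm J} (hg : IsFinitePerm g) :
    ∀ᶠ I : Finset J in atTop, g ∈ permsOn I := by
  filter_upwards [eventually_ge_atTop hg.toFinset] with I hI
  rw [mem_permsOn]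
  intro j hj
  by_contra h
  exact hj (hI (hg.mem_toFinset.mpr h))

open Classical in
theorem card_fiber (I : Finset J) (f k : J) (hf : f ∈ I) :
    ((permsOn I).filter (fun g => g f = k)).card * I.card ≤ (permsOn I).card := by
  have maps : ∀ g ∈ permsOn I, g f ∈ I := by
    intro g hg
    by_contra h
    rw [mem_permsOn] at hg
    have h3 : g f = f := g.injective (hg _ h)
    rw [h3] at h
    exact h hf
  by_cases hk : k ∈ I
  · rw [Finset.card_eq_sum_card_fiberwise (t := I) (f := fun g : Equiv.Perm J => g f) maps,
      mul_comm, ← smul_eq_mul, ← Finset.sum_const]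
    apply Finset.sum_le_sum
    intro i hi
    apply Finset.card_le_card_of_injOn (fun g => Equiv.swap k i * g)
    · intro g hg
      simp only [Finset.coe_filter, Set.mem_ofPred_eq] at hg ⊢
      refine ⟨mul_mem_permsOn ?_ hg.1, by simp [hg.2]⟩
      rw [mem_permsOn]
      intro j hj
      apply Equiv.swap_apply_of_ne_of_ne
      · rintro rfl; exact hj hk
      · rintro rfl; exact hj hi
    · intro g _ h _ hh
      exact mul_left_cancel hh
  · rw [Finset.card_eq_zero.mpr, zero_mul]
    · exact Nat.zero_le _
    · rw [Finset.filter_eq_empty_iff]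
      rintro g hg rfl
      exact hk (maps g hg)

open Classical in
theorem card_bad (I F K : Finset J) (hF : F ⊆ I) :
    ((permsOn I).filter (fun g => ∃ f ∈ F, g f ∈ K)).card * I.card
      ≤ F.card * K.card * (permsOn I).card := by
  have h : (permsOn I).filter (fun g => ∃ f ∈ F, g f ∈ K) ⊆
      (F ×ˢ K).biUnion (fun p => (permsOn I).filter (fun g => g p.1 = p.2)) := by
    intro g hg
    simp only [Finset.mem_filter, Finset.mem_biUnion, Finset.mem_product] at hg ⊢
    obtain ⟨h1, f, hf, hk⟩ := hg
    exact ⟨(f, g f), ⟨hf, hk⟩, h1, rfl⟩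
  calc _ ≤ (∑ p ∈ F ×ˢ K, ((permsOn I).filter (fun g => g p.1 = p.2)).card) * I.card :=
        Nat.mul_le_mul_right _ ((Finset.card_le_card h).trans Finset.card_biUnion_le)
    _ = ∑ p ∈ F ×ˢ K, ((permsOn I).filter (fun g => g p.1 = p.2)).card * I.card := by
        rw [Finset.sum_mul]
    _ ≤ ∑ p ∈ F ×ˢ K, (permsOn I).card := by
        apply Finset.sum_le_sum
        intro p hp
        exact card_fiber I p.1 p.2 (hF (Finset.mem_product.mp hp).1)
    _ = _ := by simp [Finset.card_product]

/-- The average over `ℙ_I` of a bounded function vanishing on permutations moving `F` off `K`. -/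
theorem norm_avg_le {E : Type*} [NormedAddCommGroup E] [NormedSpace ℂ E]
    (I F K : Finset J) (hF : F ⊆ I) (hI : 0 < I.card) (u : Equiv.Perm J → E) (C : ℝ)
    (hC : ∀ g, ‖u g‖ ≤ C)
    (h0 : ∀ g ∈ permsOn I, (∀ f ∈ F, g f ∉ K) → u g = 0) :
    ‖((permsOn I).card : ℂ)⁻¹ • ∑ g ∈ permsOn I, u g‖ ≤ C * (F.card * K.card) / I.card := by
  classical
  have hC0 : 0 ≤ C := (norm_nonneg _).trans (hC 1)
  have hP : (0 : ℝ) < (permsOn I).card := by exact_mod_cast card_permsOn_pos I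
  have hI' : (0 : ℝ) < I.card := by exact_mod_cast hI
  have h1 : ∑ g ∈ permsOn I, u g
      = ∑ g ∈ (permsOn I).filter (fun g => ∃ f ∈ F, g f ∈ K), u g := by
    symm
    apply Finset.sum_filter_of_ne
    intro g hg hne
    by_contra hcon
    push Not at hcon
    exact hne (h0 g hg hcon)
  have h2 : ‖∑ g ∈ permsOn I, u g‖
      ≤ ((permsOn I).filter (fun g => ∃ f ∈ F, g f ∈ K)).card * C := by
    rw [h1]
    refine (norm_sum_le _ _).trans ?_
    refine (Finset.sum_le_sum (fun g _ => hC g)).trans ?_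
    simp
  have h3 : (((permsOn I).filter (fun g => ∃ f ∈ F, g f ∈ K)).card : ℝ) * I.card
      ≤ F.card * K.card * (permsOn I).card := by exact_mod_cast card_bad I F K hF
  rw [norm_smul, norm_inv, Complex.norm_natCast, le_div_iff₀ hI', inv_mul_eq_div, div_mul_eq_mul_div,
    div_le_iff₀ hP]
  calc _ ≤ (((permsOn I).filter (fun g => ∃ f ∈ F, g f ∈ K)).card * C) * I.card := by gcongr
    _ = C * (((permsOn I).filter (fun g => ∃ f ∈ F, g f ∈ K)).card * I.card) := by ring
    _ ≤ C * (F.card * K.card * (permsOn I).card) := by gcongr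
    _ = _ := by ring

theorem tendsto_const_div_card [Infinite J] (C : ℝ) :
    Tendsto (fun I : Finset J => C / (I.card : ℝ)) atTop (𝓝 0) :=
  (tendsto_natCast_atTop_atTop.comp tendsto_card_atTop_atTop).const_div_atTop C

end perms


section monomials
variable {J : Type*}

/-- A creation or annihilation operator. -/
def carLetter (a : J → A) (p : J × Bool) : A := if p.2 then a p.1 else star (a p.1)

/-- A monomial in creation and annihilation operators. -/
def carMono (a : J → A) (w : List (J × Bool)) : A := (w.map (carLetter a)).prod

theorem carLetter_anticomm {a : J → A} (ha : IsCARFamily a) {p q : J × Bool} (h : q.1 ≠ p.1) :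
    carLetter a p * carLetter a q = - (carLetter a q * carLetter a p) := by
  obtain ⟨-, h2, h3, -⟩ := ha
  obtain ⟨j, b⟩ := p
  obtain ⟨k, c⟩ := q
  simp only [ne_eq] at h
  have e1 := h2 j k (fun e => h e.symm)
  have e2 := h2 k j h
  have e3 := h3 j k
  have e4 : star (a j) * star (a k) + star (a k) * star (a j) = 0 := by
    have := congrArg star e3
    simpa [add_comm] using this
  rw [eq_neg_iff_add_eq_zero]
  cases b <;> cases c <;> simp only [carLetter, if_true, Bool.false_eq_true, if_false]
  · exact e4
  · exact e1
  · rw [add_comm]; exact e2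
  · exact e3

theorem carLetter_mul_mono {a : J → A} (ha : IsCARFamily a) (p : J × Bool) (v : List (J × Bool))
    (h : ∀ q ∈ v, q.1 ≠ p.1) :
    carLetter a p * carMono a v = (-1 : ℂ) ^ v.length • (carMono a v * carLetter a p) := by
  induction v with
  | nil => simp [carMono]
  | cons q v ih =>
    have ih' := ih (fun r hr => h r (List.mem_cons_of_mem _ hr))
    have hq := carLetter_anticomm ha (h q List.mem_cons_self)
    have hc : carMono a (q :: v) = carLetter a q * carMono a v := by simp [carMono]
    rw [hc, ← mul_assoc, hq, neg_mul, mul_assoc, ih', List.length_cons, pow_succ, mul_neg_one,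
      neg_smul, mul_smul_comm, mul_assoc]

theorem carMono_mul_mono {a : J → A} (ha : IsCARFamily a) (u v : List (J × Bool))
    (h : ∀ p ∈ u, ∀ q ∈ v, q.1 ≠ p.1) :
    carMono a u * carMono a v
      = (-1 : ℂ) ^ (u.length * v.length) • (carMono a v * carMono a u) := by
  induction u with
  | nil => simp [carMono]
  | cons p u ih =>
    have ih' := ih (fun r hr => h r (List.mem_cons_of_mem _ hr))
    have hp := carLetter_mul_mono ha p v (h p List.mem_cons_self)
    have hc : carMono a (p :: u) = carLetter a p * carMono a u := by simp [carMono]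
    rw [hc, mul_assoc, ih', mul_smul_comm, ← mul_assoc, hp, smul_mul_assoc, smul_smul,
      List.length_cons, Nat.succ_mul, pow_add, mul_assoc]

theorem star_carMono (a : J → A) (u : List (J × Bool)) :
    star (carMono a u) = carMono a (u.reverse.map (fun p => (p.1, !p.2))) := by
  induction u with
  | nil => simp [carMono]
  | cons p u ih =>
    have hc : carMono a (p :: u) = carLetter a p * carMono a u := by simp [carMono]
    rw [hc, star_mul, ih]
    obtain ⟨j, b⟩ := p
    cases b <;> simp [carMono, carLetter]

theorem map_carMono (a : J → A) (α : Equiv.Perm J → (A ≃⋆ₐ[ℂ] A))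
    (hα : ∀ g : Equiv.Perm J, IsFinitePerm g → ∀ j : J, α g (a j) = a (g j))
    {g : Equiv.Perm J} (hg : IsFinitePerm g) (u : List (J × Bool)) :
    α g (carMono a u) = carMono a (u.map (fun p => (g p.1, p.2))) := by
  induction u with
  | nil => simp [carMono]
  | cons p u ih =>
    have hc : carMono a (p :: u) = carLetter a p * carMono a u := by simp [carMono]
    rw [hc, map_mul, ih]
    obtain ⟨j, b⟩ := p
    cases b <;> simp [carMono, carLetter, hα g hg, map_star]

theorem car_induction {a : J → A} (ha : IsCARFamily a) (S : Submodule ℂ A)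
    (hS : IsClosed (S : Set A)) (hm : ∀ w, carMono a w ∈ S) (x : A) : x ∈ S := by
  have h1 : (StarAlgebra.adjoin ℂ (Set.range a) : Set A) ⊆ S := by
    have h2 := StarAlgebra.adjoin_eq_span (R := ℂ) (Set.range a)
    intro z hz
    have hz' : z ∈ Submodule.span ℂ
        (Submonoid.closure (Set.range a ∪ star (Set.range a)) : Set A) := by
      rw [← h2]; exact hz
    refine (Submodule.span_le.mpr ?_) hz'
    intro y hy
    obtain ⟨l, hl, rfl⟩ := Submonoid.exists_list_of_mem_closure hy
    have : ∃ w, l.prod = carMono a w := by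
      clear hz hz' hy
      induction l with
      | nil => exact ⟨[], by simp [carMono]⟩
      | cons b l ih =>
        obtain ⟨w, hw⟩ := ih (fun y hy => hl y (List.mem_cons_of_mem _ hy))
        rcases hl b List.mem_cons_self with ⟨j, rfl⟩ | ⟨j, hj⟩
        · exact ⟨(j, true) :: w, by simp [carMono, carLetter, hw]⟩
        · refine ⟨(j, false) :: w, ?_⟩
          have : b = star (a j) := by rw [hj, star_star]
          simp [carMono, carLetter, hw, this]
    obtain ⟨w, hw⟩ := this
    rw [hw]
    exact hm w
  have hx : x ∈ (StarAlgebra.adjoin ℂ (Set.range a)).topologicalClosure := by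
    rw [ha.2.2.2]; trivial
  have hxcl : x ∈ closure (StarAlgebra.adjoin ℂ (Set.range a) : Set A) := hx
  exact closure_minimal h1 hS hxcl

/-- The automorphisms form a representation of the finite permutations. -/
theorem alpha_mul {a : J → A} (ha : IsCARFamily a) (α : Equiv.Perm J → (A ≃⋆ₐ[ℂ] A))
    (hα : ∀ g : Equiv.Perm J, IsFinitePerm g → ∀ j : J, α g (a j) = a (g j))
    {I : Finset J} {g h : Equiv.Perm J} (hg : g ∈ permsOn I) (hh : h ∈ permsOn I) (x : A) :
    α (g * h) x = α g (α h x) := by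
  have hc : ∀ g, Continuous (α g) := fun g =>
    (AddMonoidHomClass.isometry_of_norm (α g) (starAlgEquiv_norm (α g))).continuous
  let S : Submodule ℂ A :=
    { carrier := {x | α (g * h) x = α g (α h x)}
      add_mem' := by
        intro x y hx hy
        simp only [Set.mem_ofPred_eq] at *
        rw [map_add, map_add, map_add, hx, hy]
      zero_mem' := by simp
      smul_mem' := by
        intro c x hx
        simp only [Set.mem_ofPred_eq] at *
        rw [map_smul, map_smul, map_smul, hx] }
  refine car_induction ha S (isClosed_eq (hc _) ((hc g).comp (hc h))) ?_ x
  intro w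
  change α (g * h) _ = α g (α h _)
  rw [map_carMono a α hα (permsOn_isFinite (mul_mem_permsOn hg hh)),
    map_carMono a α hα (permsOn_isFinite hh), map_carMono a α hα (permsOn_isFinite hg)]
  simp [Function.comp_def]

end monomials


section averages
variable {J : Type*}

/-- The average of `x` over `ℙ_I`. -/
noncomputable def carAvg (α : Equiv.Perm J → (A ≃⋆ₐ[ℂ] A)) (I : Finset J) (x : A) : A :=
  ((permsOn I).card : ℂ)⁻¹ • ∑ g ∈ permsOn I, α g x

theorem avg_const_inv {E : Type*} [AddCommGroup E] [Module ℂ E] (I : Finset J) (x : E) :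
    ((permsOn I).card : ℂ)⁻¹ • ∑ _g ∈ permsOn I, x = x := by
  have : ((permsOn I).card : ℂ) ≠ 0 := by exact_mod_cast (card_permsOn_pos I).ne'
  rw [Finset.sum_const, ← Nat.cast_smul_eq_nsmul ℂ, smul_smul, inv_mul_cancel₀ this, one_smul]

theorem norm_avg_le_const {E : Type*} [NormedAddCommGroup E] [NormedSpace ℂ E] (I : Finset J)
    (u : Equiv.Perm J → E) (C : ℝ) (hu : ∀ g ∈ permsOn I, ‖u g‖ ≤ C) :
    ‖((permsOn I).card : ℂ)⁻¹ • ∑ g ∈ permsOn I, u g‖ ≤ C := by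
  have hP : (0 : ℝ) < (permsOn I).card := by exact_mod_cast card_permsOn_pos I
  rw [norm_smul, norm_inv, Complex.norm_natCast, inv_mul_le_iff₀ hP]
  refine (norm_sum_le _ _).trans ((Finset.sum_le_sum hu).trans ?_)
  simp

variable (α : Equiv.Perm J → (A ≃⋆ₐ[ℂ] A)) (I : Finset J)

theorem carAvg_add (x y : A) : carAvg α I (x + y) = carAvg α I x + carAvg α I y := by
  simp [carAvg, Finset.sum_add_distrib]

theorem carAvg_smul (c : ℂ) (x : A) : carAvg α I (c • x) = c • carAvg α I x := by
  simp only [carAvg, map_smul, ← Finset.smul_sum]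
  rw [smul_comm]

theorem carAvg_zero : carAvg α I 0 = 0 := by
  simp [carAvg]

theorem carAvg_star (x : A) : star (carAvg α I x) = carAvg α I (star x) := by
  simp [carAvg, star_smul, map_star]

theorem norm_carAvg_le (x : A) : ‖carAvg α I x‖ ≤ ‖x‖ :=
  norm_avg_le_const I _ _ (fun g _ => (starAlgEquiv_norm (α g) x).le)

theorem carAvg_mul_right (x y : A) :
    carAvg α I x * y = ((permsOn I).card : ℂ)⁻¹ • ∑ g ∈ permsOn I, α g x * y := by
  rw [carAvg, smul_mul_assoc, Finset.sum_mul]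

theorem mul_carAvg_left (x y : A) :
    y * carAvg α I x = ((permsOn I).card : ℂ)⁻¹ • ∑ g ∈ permsOn I, y * α g x := by
  rw [carAvg, mul_smul_comm, Finset.mul_sum]

variable {α I}

theorem alpha_carAvg {a : J → A} (ha : IsCARFamily a)
    (hα : ∀ g : Equiv.Perm J, IsFinitePerm g → ∀ j : J, α g (a j) = a (g j))
    {h : Equiv.Perm J} (hh : h ∈ permsOn I) (x : A) :
    α h (carAvg α I x) = carAvg α I x := by
  rw [carAvg, map_smul, map_sum]
  congr 1
  refine Finset.sum_bij (fun g _ => h * g) (fun g hg => mul_mem_permsOn hh hg)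
    (fun g _ g' _ e => mul_left_cancel e) ?_ ?_
  · intro g hg
    exact ⟨h⁻¹ * g, mul_mem_permsOn (inv_mem_permsOn hh) hg, by simp⟩
  · intro g hg
    exact (alpha_mul ha α hα hh hg x).symm

/-- Uniformly bounded linear maps tending to zero on monomials tend to zero everywhere. -/
theorem car_tendsto_zero {a : J → A} (ha : IsCARFamily a) (T : Finset J → A → A)
    (hadd : ∀ I x y, T I (x + y) = T I x + T I y) (hsmul : ∀ I (c : ℂ) x, T I (c • x) = c • T I x)
    (C : ℝ) (hC : ∀ I x, ‖T I x‖ ≤ C * ‖x‖)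
    (hm : ∀ w, Tendsto (fun I => T I (carMono a w)) atTop (𝓝 0)) (x : A) :
    Tendsto (fun I => T I x) atTop (𝓝 0) := by
  let S : Submodule ℂ A :=
    { carrier := {x | Tendsto (fun I => T I x) atTop (𝓝 0)}
      add_mem' := by
        intro x y hx hy
        simp only [Set.mem_ofPred_eq, hadd] at *
        simpa using hx.add hy
      zero_mem' := by
        have : ∀ I, T I 0 = 0 := fun I => by simpa using hsmul I 0 0
        simp [this]
      smul_mem' := by
        intro c x hx
        simp only [Set.mem_ofPred_eq, hsmul] at *
        simpa using hx.const_smul c }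
  have hsub : ∀ I x y, T I (x - y) = T I x - T I y := by
    intro I x y
    have := hadd I (x - y) y
    rw [sub_add_cancel] at this
    rw [this, add_sub_cancel_right]
  refine car_induction ha S ?_ hm x
  rw [← isSeqClosed_iff_isClosed]
  intro u z hu hz
  change Tendsto (fun I => T I z) atTop (𝓝 0)
  rw [Metric.tendsto_nhds]
  intro ε hε
  have hC1 : 0 < |C| + 1 := by positivity
  obtain ⟨n, hn⟩ := ((Metric.tendsto_nhds.mp hz) (ε / 2 / (|C| + 1)) (by positivity)).exists
  have h2 := (Metric.tendsto_nhds.mp (hu n : Tendsto (fun I => T I (u n)) atTop (𝓝 0)))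
    (ε / 2) (by positivity)
  filter_upwards [h2] with I hI
  rw [dist_zero_right] at hI ⊢
  rw [dist_comm, dist_eq_norm, lt_div_iff₀ hC1] at hn
  have h3 : T I z = T I (z - u n) + T I (u n) := by rw [← hadd, sub_add_cancel]
  have h4 : ‖T I (z - u n)‖ ≤ ‖z - u n‖ * (|C| + 1) := by
    refine (hC I _).trans ?_
    rw [mul_comm]
    gcongr
    exact (le_abs_self C).trans (by simp)
  calc ‖T I z‖ ≤ ‖T I (z - u n)‖ + ‖T I (u n)‖ := by rw [h3]; exact norm_add_le _ _
    _ < ε := by linarith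

/-- Odd monomials have vanishing averages. -/
theorem carAvg_odd [Infinite J] {a : J → A} (ha : IsCARFamily a)
    (hα : ∀ g : Equiv.Perm J, IsFinitePerm g → ∀ j : J, α g (a j) = a (g j))
    (w : List (J × Bool)) (hw : Odd w.length) :
    Tendsto (fun I => carAvg α I (carMono a w)) atTop (𝓝 0) := by
  classical
  set x := carMono a w with hx
  set F : Finset J := (w.map Prod.fst).toFinset with hF
  set C : ℝ := 2 * (‖x‖ * ‖x‖) with hCdef
  have key : ∀ᶠ I : Finset J in atTop,
      ‖carAvg α I x‖ ^ 2 ≤ (C * (F.card * F.card)) / I.card := by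
    obtain ⟨j0⟩ := (inferInstance : Nonempty J)
    filter_upwards [eventually_ge_atTop F, eventually_ge_atTop {j0}] with I hI hI0
    have hIpos : 0 < I.card := Finset.card_pos.mpr ⟨j0, hI0 (by simp)⟩
    refine (norm_sq_le_anticomm _).trans ?_
    rw [carAvg_star]
    have e : carAvg α I (star x) * carAvg α I x + carAvg α I x * carAvg α I (star x)
        = ((permsOn I).card : ℂ)⁻¹ • ∑ h ∈ permsOn I, (((permsOn I).card : ℂ)⁻¹ •
            ∑ g ∈ permsOn I, (α g (star x) * α h x + α h x * α g (star x))) := by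
      rw [mul_carAvg_left α I x, carAvg_mul_right α I x, ← smul_add, ← Finset.sum_add_distrib]
      congr 1
      apply Finset.sum_congr rfl
      intro h _
      rw [mul_carAvg_left, carAvg_mul_right, ← smul_add, ← Finset.sum_add_distrib]
    rw [e]
    apply norm_avg_le_const
    intro h hh
    have hcard : (F.image h).card = F.card := Finset.card_image_of_injective _ h.injective
    have := norm_avg_le I F (F.image h) hI hIpos
      (fun g => α g (star x) * α h x + α h x * α g (star x)) C ?_ ?_
    · rw [hcard] at this
      exact this
    · intro g
      refine (norm_add_le _ _).trans ?_
      refine (add_le_add (norm_mul_le _ _) (norm_mul_le _ _)).trans ?_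
      simp only [starAlgEquiv_norm, norm_star, hCdef]
      linarith
    · intro g hg hgood
      rw [hx, star_carMono, map_carMono a α hα (permsOn_isFinite hg),
        map_carMono a α hα (permsOn_isFinite hh), carMono_mul_mono ha]
      · have : Odd (w.length * w.length) := hw.mul hw
        simp [this.neg_one_pow]
      · intro p hp q hq heq
        simp only [List.mem_map, List.mem_reverse] at hp hq
        obtain ⟨p', ⟨p'', hp'', rfl⟩, rfl⟩ := hp
        obtain ⟨q', hq', rfl⟩ := hq
        simp only at heq
        refine hgood p''.1 ?_ ?_
        · simp only [hF, List.mem_toFinset, List.mem_map]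
          exact ⟨p'', hp'', rfl⟩
        · rw [← heq]
          apply Finset.mem_image_of_mem
          simp only [hF, List.mem_toFinset, List.mem_map]
          exact ⟨q', hq', rfl⟩
  have h2 : Tendsto (fun I => ‖carAvg α I x‖ ^ 2) atTop (𝓝 0) :=
    squeeze_zero' (Eventually.of_forall fun I => by positivity) key (tendsto_const_div_card _)
  rw [tendsto_zero_iff_norm_tendsto_zero]
  have h3 := h2.sqrt
  simpa using h3

/-- Asymptotic centrality of the averages. -/
theorem carAvg_central [Infinite J] {a : J → A} (ha : IsCARFamily a)
    (hα : ∀ g : Equiv.Perm J, IsFinitePerm g → ∀ j : J, α g (a j) = a (g j)) (x y : A) :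
    Tendsto (fun I => carAvg α I x * y - y * carAvg α I x) atTop (𝓝 0) := by
  classical
  refine car_tendsto_zero ha (fun I y => carAvg α I x * y - y * carAvg α I x) ?_ ?_ (2 * ‖x‖) ?_ ?_ y
  · intro I x y; noncomm_ring
  · intro I c x; simp only [mul_smul_comm, smul_mul_assoc, smul_sub]
  · intro I y
    refine (norm_sub_le _ _).trans ((add_le_add (norm_mul_le _ _) (norm_mul_le _ _)).trans ?_)
    have h1 := mul_le_mul_of_nonneg_right (norm_carAvg_le α I x) (norm_nonneg y)
    linarith
  intro v
  refine car_tendsto_zero ha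
    (fun I x => carAvg α I x * carMono a v - carMono a v * carAvg α I x) ?_ ?_
    (2 * ‖carMono a v‖) ?_ ?_ x
  · intro I x y
    simp only [carAvg_add, add_mul, mul_add]
    abel
  · intro I c x; simp only [carAvg_smul, mul_smul_comm, smul_mul_assoc, smul_sub]
  · intro I x
    refine (norm_sub_le _ _).trans ((add_le_add (norm_mul_le _ _) (norm_mul_le _ _)).trans ?_)
    have h1 := mul_le_mul_of_nonneg_right (norm_carAvg_le α I x) (norm_nonneg (carMono a v))
    linarith
  intro w
  rcases Nat.even_or_odd w.length with hw | hw
  swap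
  · have h := carAvg_odd (α := α) ha hα w hw
    simpa using (h.mul_const (carMono a v)).sub (h.const_mul (carMono a v))
  set x := carMono a w with hx
  set y := carMono a v with hy
  set F : Finset J := (w.map Prod.fst).toFinset with hF
  set K : Finset J := (v.map Prod.fst).toFinset with hK
  obtain ⟨j0⟩ := (inferInstance : Nonempty J)
  refine squeeze_zero_norm' ?_ (tendsto_const_div_card (2 * (‖x‖ * ‖y‖) * (F.card * K.card)))
  filter_upwards [eventually_ge_atTop F, eventually_ge_atTop {j0}] with I hI hI0
  have hIpos : 0 < I.card := Finset.card_pos.mpr ⟨j0, hI0 (by simp)⟩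
  rw [mul_carAvg_left, carAvg_mul_right, ← smul_sub, ← Finset.sum_sub_distrib]
  refine norm_avg_le I F K hI hIpos (fun g => α g x * y - y * α g x) _ ?_ ?_
  · intro g
    refine (norm_sub_le _ _).trans ((add_le_add (norm_mul_le _ _) (norm_mul_le _ _)).trans ?_)
    simp only [starAlgEquiv_norm]
    linarith
  · intro g hg hgood
    rw [hx, map_carMono a α hα (permsOn_isFinite hg), hy, carMono_mul_mono ha]
    · have : Even (w.length * v.length) := hw.mul_right _
      simp [this.neg_one_pow]
    · intro p hp q hq heq
      simp only [List.mem_map] at hp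
      obtain ⟨p', hp', rfl⟩ := hp
      simp only at heq
      refine hgood p'.1 ?_ ?_
      · simp only [hF, List.mem_toFinset, List.mem_map]
        exact ⟨p', hp', rfl⟩
      · rw [← heq]
        simp only [hK, List.mem_toFinset, List.mem_map]
        exact ⟨q, hq, rfl⟩

end averages


section mainproof
variable {J : Type*} {α : Equiv.Perm J → (A ≃⋆ₐ[ℂ] A)}

theorem phi_avg (φ : A →ₗ[ℂ] ℂ) (I : Finset J) (x y : A) :
    φ (carAvg α I x * y) = ((permsOn I).card : ℂ)⁻¹ * ∑ g ∈ permsOn I, φ (α g x * y) := by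
  rw [carAvg_mul_right, map_smul, map_sum, smul_eq_mul]

theorem phi_carAvg {φ : A →ₗ[ℂ] ℂ} (hφ : φ ∈ SymmetricStates α) (I : Finset J) (x : A) :
    φ (carAvg α I x) = φ x := by
  have h1 : ∑ g ∈ permsOn I, φ (α g x) = ∑ _g ∈ permsOn I, φ x :=
    Finset.sum_congr rfl fun g hg => hφ.2 g (permsOn_isFinite hg) x
  rw [carAvg, map_smul, map_sum, h1, avg_const_inv]

theorem extreme_of_clustering {a : J → A} (ha : IsCARFamily a)
    (hα : ∀ g : Equiv.Perm J, IsFinitePerm g → ∀ j : J, α g (a j) = a (g j))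
    {φ : A →ₗ[ℂ] ℂ} (hφ : φ ∈ SymmetricStates α)
    (hcl : ∀ x y, Tendsto (fun I => φ (carAvg α I x * y)) atTop (𝓝 (φ x * φ y))) :
    φ ∈ Set.extremePoints ℝ (SymmetricStates α) := by
  rw [mem_extremePoints_iff_left]
  refine ⟨hφ, ?_⟩
  rintro ψ₁ h₁ ψ₂ h₂ ⟨t, s, ht, hs, hts, heq⟩
  ext x
  set D : Finset J → A := fun I => carAvg α I x - φ x • (1 : A) with hD
  have hφD : ∀ I, φ (star (D I) * D I) = φ (carAvg α I (star x) * x) - φ (star x) * φ x := by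
    intro I
    have e1 : φ (carAvg α I (star x) * carAvg α I x) = φ (carAvg α I (star x) * x) := by
      have : ∀ h ∈ permsOn I, φ (carAvg α I (star x) * α h x) = φ (carAvg α I (star x) * x) := by
        intro h hh
        rw [← hφ.2 h (permsOn_isFinite hh) (carAvg α I (star x) * x), map_mul (α h),
          alpha_carAvg ha hα hh]
      rw [mul_carAvg_left, map_smul, map_sum, Finset.sum_congr rfl this, avg_const_inv]
    have e2 : star (D I) * D I = carAvg α I (star x) * carAvg α I x - φ x • carAvg α I (star x)
        - φ (star x) • carAvg α I x + (φ x * φ (star x)) • (1 : A) := by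
      simp only [hD, star_sub, star_smul, star_one, carAvg_star, hφ.1.map_star', sub_mul, mul_sub,
        smul_mul_assoc, mul_smul_comm, one_mul, mul_one, smul_sub, smul_smul]
      abel
    rw [e2, map_add, map_sub, map_sub, e1, map_smul, map_smul, map_smul, phi_carAvg hφ,
      phi_carAvg hφ, hφ.1.1]
    simp only [smul_eq_mul]
    ring
  have hlim : Tendsto (fun I => (φ (star (D I) * D I)).re) atTop (𝓝 0) := by
    have h := (hcl (star x) x).sub_const (φ (star x) * φ x)
    simp only [sub_self] at h
    have h' := (Complex.continuous_re.tendsto 0).comp h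
    simpa [Function.comp_def, hφD] using h'
  have hle : ∀ I, t * ‖ψ₁ x - φ x‖ ^ 2 ≤ (φ (star (D I) * D I)).re := by
    intro I
    have e1 : ψ₁ (D I) = ψ₁ x - φ x := by
      simp [hD, phi_carAvg h₁, h₁.1.1]
    have e2 := h₁.1.cs (D I)
    rw [e1] at e2
    have e3 : 0 ≤ (ψ₂ (star (D I) * D I)).re := (Complex.nonneg_iff.mp (h₂.1.2 _)).1
    have e4 : (φ (star (D I) * D I)).re
        = t * (ψ₁ (star (D I) * D I)).re + s * (ψ₂ (star (D I) * D I)).re := by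
      rw [← heq]
      simp
    rw [e4]
    have := mul_le_mul_of_nonneg_left e2 ht.le
    have := mul_nonneg hs.le e3
    linarith
  have h0 : t * ‖ψ₁ x - φ x‖ ^ 2 ≤ 0 := ge_of_tendsto hlim (Eventually.of_forall hle)
  have h5 : ‖ψ₁ x - φ x‖ ^ 2 ≤ 0 := by
    by_contra hcon
    push Not at hcon
    have := mul_pos ht hcon
    linarith
  have h6 : ‖ψ₁ x - φ x‖ = 0 := by
    have := le_antisymm h5 (by positivity)
    exact pow_eq_zero_iff (two_ne_zero) |>.mp this
  exact sub_eq_zero.mp (norm_eq_zero.mp h6)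

theorem eq_ofReal_of_nonneg {z : ℂ} (h : 0 ≤ z) : z = (z.re : ℂ) :=
  Complex.ext rfl (by simpa using (Complex.nonneg_iff.mp h).2.symm)

theorem clustering_sq [Infinite J] {a : J → A} (ha : IsCARFamily a)
    (hα : ∀ g : Equiv.Perm J, IsFinitePerm g → ∀ j : J, α g (a j) = a (g j))
    {φ : A →ₗ[ℂ] ℂ} (hφ : φ ∈ Set.extremePoints ℝ (SymmetricStates α)) (z y : A) :
    Tendsto (fun I => φ (carAvg α I (star z * z) * y)) atTop (𝓝 (φ (star z * z) * φ y)) := by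
  rw [mem_extremePoints_iff_left] at hφ
  obtain ⟨hs, hext⟩ := hφ
  obtain ⟨C, hC0, hC⟩ := hs.1.bound
  have hcont : Continuous φ := (φ.mkContinuous C hC).continuous
  set x := star z * z with hx
  rw [tendsto_iff_ultrafilter]
  intro U hU
  have hex : ∀ y, ∃ l, Tendsto (fun I => φ (carAvg α I x * y)) U (𝓝 l) := by
    intro y
    have hmem : ∀ I : Finset J,
        φ (carAvg α I x * y) ∈ Metric.closedBall (0 : ℂ) (C * (‖x‖ * ‖y‖)) := by
      intro I
      rw [mem_closedBall_zero_iff]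
      refine (hC _).trans ?_
      gcongr
      refine (norm_mul_le _ _).trans ?_
      gcongr
      exact norm_carAvg_le α I x
    obtain ⟨l, -, hl⟩ := (isCompact_closedBall (0 : ℂ) (C * (‖x‖ * ‖y‖))).ultrafilter_le_nhds
      (U.map (fun I => φ (carAvg α I x * y)))
      (by
        rw [le_principal_iff]
        exact Filter.mem_map.mpr (Filter.univ_mem' hmem))
    exact ⟨l, hl⟩
  choose ψ hψ using hex
  let Ψ : A →ₗ[ℂ] ℂ :=
    { toFun := ψ
      map_add' := by
        intro y y'
        refine tendsto_nhds_unique (hψ (y + y')) ?_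
        simpa [mul_add] using (hψ y).add (hψ y')
      map_smul' := by
        intro c y
        refine tendsto_nhds_unique (hψ (c • y)) ?_
        simpa using (hψ y).const_mul c }
  have hΨ : ∀ y, Tendsto (fun I => φ (carAvg α I x * y)) U (𝓝 (Ψ y)) := hψ
  have hΨ1 : Ψ 1 = φ x := by
    refine tendsto_nhds_unique (hΨ 1) ?_
    simp [phi_carAvg hs]
  have hΨsymm : ∀ g, IsFinitePerm g → ∀ y, Ψ (α g y) = Ψ y := by
    intro g hg y
    refine tendsto_nhds_unique (hΨ (α g y)) ((hΨ y).congr' ?_)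
    filter_upwards [hU (eventually_mem_permsOn hg)] with I hI
    rw [← hs.2 g hg (carAvg α I x * y), map_mul, alpha_carAvg ha hα hI]
  -- the conjugated averages
  have hconj : ∀ y, Tendsto (fun I => φ (star y * carAvg α I x * y)) U (𝓝 (Ψ (star y * y))) := by
    intro y
    have h1 : Tendsto (fun I => φ ((carAvg α I x * star y - star y * carAvg α I x) * y)) U
        (𝓝 0) := by
      have h2 := ((carAvg_central (α := α) ha hα x (star y)).mono_left hU).mul_const y
      rw [zero_mul] at h2
      have h3 := (hcont.tendsto 0).comp h2
      rw [map_zero] at h3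
      exact h3
    have h4 := (hΨ (star y * y)).sub h1
    rw [sub_zero] at h4
    refine h4.congr ?_
    intro I
    rw [← map_sub]
    congr 1
    noncomm_ring
  have hform : ∀ (I : Finset J) (y : A), φ (star y * carAvg α I x * y)
      = (((permsOn I).card : ℝ)⁻¹ * ∑ g ∈ permsOn I,
          (φ (star (α g z * y) * (α g z * y))).re : ℝ) := by
    intro I y
    push_cast
    rw [mul_carAvg_left, smul_mul_assoc, map_smul, Finset.sum_mul, map_sum, smul_eq_mul]
    congr 1
    apply Finset.sum_congr rfl
    intro g _
    rw [← eq_ofReal_of_nonneg (hs.1.2 _), hx, map_mul (α g), map_star (α g), star_mul]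
    congr 1
    noncomm_ring
  have hpos : ∀ y, 0 ≤ Ψ (star y * y) := by
    intro y
    refine ge_of_tendsto (hconj y) (Eventually.of_forall fun I => ?_)
    rw [hform]
    rw [Complex.zero_le_real]
    refine mul_nonneg (by positivity) (Finset.sum_nonneg fun g _ => ?_)
    exact (Complex.nonneg_iff.mp (hs.1.2 _)).1
  have hupper : ∀ y, (Ψ (star y * y)).re ≤ ‖z‖ ^ 2 * (φ (star y * y)).re := by
    intro y
    refine le_of_tendsto ((Complex.continuous_re.tendsto _).comp (hconj y))
      (Eventually.of_forall fun I => ?_)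
    simp only [Function.comp_apply]
    rw [hform, Complex.ofReal_re]
    have hP : (0 : ℝ) < (permsOn I).card := by exact_mod_cast card_permsOn_pos I
    rw [inv_mul_le_iff₀ hP]
    refine (Finset.sum_le_card_nsmul _ _ (‖z‖ ^ 2 * (φ (star y * y)).re) ?_).trans ?_
    · intro g _
      have := hs.1.conj_le (α g z) y
      rwa [starAlgEquiv_norm] at this
    · rw [nsmul_eq_mul]
  -- the perturbed states
  set c : ℝ := (φ x).re with hc
  have hφx : φ x = (c : ℂ) := eq_ofReal_of_nonneg (hs.1.2 z)
  have hc0 : 0 ≤ c := (Complex.nonneg_iff.mp (hs.1.2 z)).1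
  have hc1 : c ≤ ‖z‖ ^ 2 := by
    have := hs.1.conj_le z 1
    simpa [hs.1.1] using this
  set ε : ℝ := (‖z‖ ^ 2 + 1)⁻¹ with hε
  have hε0 : 0 < ε := by positivity
  have hε1 : ε * ‖z‖ ^ 2 ≤ 1 := by
    rw [hε, inv_mul_le_iff₀ (by positivity)]
    linarith
  have hstate : ∀ σ : ℝ, (σ = 1 ∨ σ = -1) →
      (φ + (((σ * ε : ℝ) : ℂ)) • (Ψ - (c : ℂ) • φ)) ∈ SymmetricStates α := by
    intro σ hσ
    refine ⟨⟨?_, ?_⟩, ?_⟩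
    · simp [hs.1.1, hΨ1, hφx]
    · intro y
      have hp := hs.1.2 y
      have hq := hpos y
      have hu := hupper y
      have hp0 := (Complex.nonneg_iff.mp hp).1
      have hq0 := (Complex.nonneg_iff.mp hq).1
      simp only [LinearMap.add_apply, LinearMap.smul_apply, LinearMap.sub_apply, smul_eq_mul]
      rw [eq_ofReal_of_nonneg hp, eq_ofReal_of_nonneg hq]
      generalize (φ (star y * y)).re = p at *
      generalize (Ψ (star y * y)).re = q at *
      norm_cast
      have k1 : ε * c * p ≤ p := by
        have : ε * c ≤ 1 := (mul_le_mul_of_nonneg_left hc1 hε0.le).trans hε1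
        calc ε * c * p ≤ 1 * p := by gcongr
          _ = p := one_mul p
      have k2 : ε * q ≤ p := by
        calc ε * q ≤ ε * (‖z‖ ^ 2 * p) := by gcongr
          _ = (ε * ‖z‖ ^ 2) * p := by ring
          _ ≤ 1 * p := by gcongr
          _ = p := one_mul p
      have k3 : 0 ≤ ε * c * p := by positivity
      have k4 : 0 ≤ ε * q := by positivity
      rcases hσ with rfl | rfl
      · nlinarith
      · nlinarith
    · intro g hg y
      simp [hΨsymm g hg, hs.2 g hg]
  have hfin := hext _ (hstate 1 (Or.inl rfl)) _ (hstate (-1) (Or.inr rfl)) (by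
    refine ⟨1 / 2, 1 / 2, by norm_num, by norm_num, by norm_num, ?_⟩
    ext y
    simp
    ring)
  have hval := LinearMap.congr_fun hfin y
  simp only [LinearMap.add_apply, LinearMap.smul_apply, LinearMap.sub_apply, smul_eq_mul, one_mul,
    add_eq_left, mul_eq_zero, Complex.ofReal_eq_zero, hε0.ne', false_or, sub_eq_zero] at hval
  have := hΨ y
  rw [hval, ← hφx] at this
  exact this

theorem polar_identity (x : A) : x = (1 / 4 : ℂ) • (star (x + 1) * (x + 1)
    + Complex.I • (star (x + Complex.I • (1 : A)) * (x + Complex.I • (1 : A)))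
    + (-1 : ℂ) • (star (x + (-1 : ℂ) • (1 : A)) * (x + (-1 : ℂ) • (1 : A)))
    + (-Complex.I) • (star (x + (-Complex.I) • (1 : A)) * (x + (-Complex.I) • (1 : A)))) := by
  simp only [star_add, star_smul, star_one, add_mul, mul_add, smul_mul_assoc, mul_smul_comm,
    one_mul, mul_one, smul_add, smul_smul, Complex.star_def, map_neg, Complex.conj_I, map_one]
  have hI : Complex.I * Complex.I = -1 := Complex.I_mul_I
  match_scalars <;> simp <;> ring_nf

theorem clustering_of_extreme [Infinite J] {a : J → A} (ha : IsCARFamily a)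
    (hα : ∀ g : Equiv.Perm J, IsFinitePerm g → ∀ j : J, α g (a j) = a (g j))
    {φ : A →ₗ[ℂ] ℂ} (hφ : φ ∈ Set.extremePoints ℝ (SymmetricStates α)) (x y : A) :
    Tendsto (fun I => φ (carAvg α I x * y)) atTop (𝓝 (φ x * φ y)) := by
  have hadd : ∀ u v, Tendsto (fun I => φ (carAvg α I u * y)) atTop (𝓝 (φ u * φ y)) →
      Tendsto (fun I => φ (carAvg α I v * y)) atTop (𝓝 (φ v * φ y)) →
      Tendsto (fun I => φ (carAvg α I (u + v) * y)) atTop (𝓝 (φ (u + v) * φ y)) := by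
    intro u v hu hv
    simpa [carAvg_add, add_mul] using hu.add hv
  have hsm : ∀ (c : ℂ) u, Tendsto (fun I => φ (carAvg α I u * y)) atTop (𝓝 (φ u * φ y)) →
      Tendsto (fun I => φ (carAvg α I (c • u) * y)) atTop (𝓝 (φ (c • u) * φ y)) := by
    intro c u hu
    simpa [carAvg_smul, mul_assoc] using hu.const_mul c
  have hsq := fun z => clustering_sq ha hα hφ z y
  rw [polar_identity x]
  exact hsm _ _ (hadd _ _ (hadd _ _ (hadd _ _ (hsq _) (hsm _ _ (hsq _))) (hsm _ _ (hsq _)))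
    (hsm _ _ (hsq _)))

end mainproof

end CARAux

/-- A symmetric state on the CAR algebra over an infinite index set `J` is an extreme
point of the convex set of symmetric states if and only if it is weakly clustering:
the net (over finite `I ⊆ J`) of averages `(1/|ℙ_I|) Σ_{g ∈ ℙ_I} φ(α_g(x)·y)` converges
to `φ(x)·φ(y)` for all `x, y`. -/
theorem symmetric_state_extreme_iff_weakly_clustering {J : Type*} [Infinite J]
    {A : Type*} [NormedRing A] [StarRing A] [CStarRing A] [NormedAlgebra ℂ A]
    [StarModule ℂ A] [CompleteSpace A]
    (a : J → A) (ha : IsCARFamily a)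
    (α : Equiv.Perm J → (A ≃⋆ₐ[ℂ] A))
    (hα : ∀ g : Equiv.Perm J, IsFinitePerm g → ∀ j : J, α g (a j) = a (g j))
    (φ : A →ₗ[ℂ] ℂ) (hφ : φ ∈ SymmetricStates α) :
    φ ∈ Set.extremePoints ℝ (SymmetricStates α) ↔
      ∀ x y : A,
        Tendsto
          (fun I : Finset J => ((permsOn I).card : ℂ)⁻¹ *
            ∑ g ∈ permsOn I, φ (α g x * y))
          atTop (𝓝 (φ x * φ y)) := by
  letI : CStarAlgebra A := {}
  have hiff : (∀ x y : A, Tendsto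
          (fun I : Finset J => ((permsOn I).card : ℂ)⁻¹ *
            ∑ g ∈ permsOn I, φ (α g x * y))
          atTop (𝓝 (φ x * φ y))) ↔
      ∀ x y : A, Tendsto (fun I => φ (carAvg α I x * y)) atTop (𝓝 (φ x * φ y)) := by
    simp only [phi_avg]
  rw [hiff]
  exact ⟨fun h => clustering_of_extreme ha hα h, fun h => extreme_of_clustering ha hα hφ h⟩
end

section
/- Let A be a unital C*-algebra, (a_j)_{j≥1} a CAR family over the positive integers in A, and (α_g)_{g∈ℙ_ℕ} a family of *-algebra automorphisms of A implementing the finite permutations. For n ≥ 1 define the permutation g_n of the positive integers by g_n(k) = 2^{n−1}+k if 1 ≤ k ≤ 2^{n−1}, g_n(k) = k−2^{n−1} if 2^{n−1} < k ≤ 2^n, and g_n(k) = k if k > 2^n. Then for a symmetric state φ on A the following are equivalent: (i) φ is an extreme point of the convex set of symmetric states; (ii) φ is strongly clustering, i.e. lim_{n→∞} φ(α_{g_n}(x)·y) = φ(x)·φ(y) for all x, y ∈ A; (iii) φ is a product state, i.e. φ(A₁·A₂·⋯·Aₘ) = φ(A₁)·φ(A₂)·⋯·φ(Aₘ) whenever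 j₁,…,jₘ are pairwise distinct positive integers and each A_k belongs to the C*-subalgebra of A generated by a_{j_k} (equivalently, φ is the product, over all sites, of a single even state on one site). -/
open scoped ComplexOrder
open Filter Topology

/-- The swap of the two halves of a block of length `2·m` at the bottom of `ℕ`. -/
def halfSwapFun (m k : ℕ) : ℕ :=
  if k < m then k + m else if k < 2 * m then k - m else k

theorem halfSwapFun_involutive (m : ℕ) : Function.Involutive (halfSwapFun m) := by
  intro k
  unfold halfSwapFun
  split_ifs <;> omega

/-- Størmer's sequence of permutations: `gswap n` (for `n ≥ 1`) exchanges the first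
`2^(n−1)` sites with the next `2^(n−1)` sites and fixes everything above `2^n`
(the sites `ℕ` label the positive integers, `k ↔ k+1`). -/
def gswap (n : ℕ) : Equiv.Perm ℕ :=
  Function.Involutive.toPerm _ (halfSwapFun_involutive (2 ^ (n - 1)))

/-- A product state: `φ(A₁⋯Aₘ) = φ(A₁)⋯φ(Aₘ)` whenever the `Aₖ` lie in the
C*-subalgebras generated by `a_{jₖ}` for pairwise distinct sites `jₖ`. -/
def IsProductState {J : Type*} {A : Type*} [NormedRing A] [StarRing A] [CStarRing A]
    [NormedAlgebra ℂ A] [StarModule ℂ A] [CompleteSpace A]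
    (a : J → A) (φ : A →ₗ[ℂ] ℂ) : Prop :=
  ∀ (m : ℕ) (j : Fin m → J), Function.Injective j →
    ∀ x : Fin m → A,
      (∀ k : Fin m, x k ∈ (StarAlgebra.adjoin ℂ ({a (j k)} : Set A)).topologicalClosure) →
      φ (List.ofFn x).prod = ∏ k : Fin m, φ (x k)

section Helpers

variable {A : Type*} [NormedRing A] [StarRing A] [CStarRing A] [NormedAlgebra ℂ A]
    [StarModule ℂ A] [CompleteSpace A]

/-! ### Basic facts on states -/

theorem IsState.exists_pos_s9 {φ : A →ₗ[ℂ] ℂ} (hφ : IsState φ) :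
    (∃ C : ℝ, 0 < C ∧ ∀ x, ‖φ x‖ ≤ C * ‖x‖) ∧ ∀ x, φ (star x) = star (φ x) := by
  letI : CStarAlgebra A := { }
  letI := CStarAlgebra.spectralOrder A
  haveI := CStarAlgebra.spectralOrderedRing A
  let f : A →ₚ[ℂ] ℂ := PositiveLinearMap.mk₀ φ (by
    intro x hx
    obtain ⟨y, rfl⟩ := CStarAlgebra.nonneg_iff_eq_star_mul_self.1 hx
    exact hφ.2 y)
  constructor
  · obtain ⟨C, hC⟩ := f.exists_norm_apply_le
    refine ⟨C + 1, by positivity, fun x => (hC x).trans ?_⟩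
    have := norm_nonneg x
    nlinarith
  · intro x
    exact map_star f x

theorem IsState.cauchy_schwarz {φ : A →ₗ[ℂ] ℂ} (hφ : IsState φ) (x y : A) :
    ‖φ (star x * y)‖ ^ 2 ≤ (φ (star x * x)).re * (φ (star y * y)).re := by
  let c : PreInnerProductSpace.Core ℂ A :=
    { inner := fun x y => φ (star x * y)
      conj_inner_symm := fun x y => by
        have := hφ.exists_pos_s9.2 (star y * x)
        simp only [star_mul, star_star] at this
        rw [this]; rfl
      re_inner_nonneg := fun x => (Complex.nonneg_iff.1 (hφ.2 x)).1
      add_left := fun x y z => by simp [add_mul]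
      smul_left := fun x y r => by simp }
  have := @InnerProductSpace.Core.inner_mul_inner_self_le ℂ A _ _ _ c x y
  have h2 : ‖φ (star y * x)‖ = ‖φ (star x * y)‖ := by
    have := hφ.exists_pos_s9.2 (star x * y)
    simp only [star_mul, star_star] at this
    rw [this, norm_star]
  change ‖φ (star x * y)‖ * ‖φ (star y * x)‖ ≤ _ at this
  rw [h2, ← sq] at this
  exact this

theorem IsState.cauchy_schwarz_one {φ : A →ₗ[ℂ] ℂ} (hφ : IsState φ) (y : A) :
    ‖φ y‖ ^ 2 ≤ (φ (star y * y)).re := by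
  have := hφ.cauchy_schwarz 1 y
  simpa [hφ.1] using this

theorem norm_auto_apply (g : A ≃⋆ₐ[ℂ] A) (x : A) : ‖g x‖ = ‖x‖ := by
  letI : CStarAlgebra A := { }
  exact NonUnitalStarAlgHom.norm_map (g : A →⋆ₙₐ[ℂ] A) g.injective x

/-- Uniformly bounded additive maps: the set of points where they tend to zero is closed. -/
theorem isClosed_tendsto_zero {E F : Type*} [SeminormedAddCommGroup E] [SeminormedAddCommGroup F]
    {ι : Type*} (l : Filter ι) (H : ι → E →+ F) (C : ℝ) (hC : 0 < C)
    (hH : ∀ i x, ‖H i x‖ ≤ C * ‖x‖) :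
    IsClosed {x | Tendsto (fun i => H i x) l (𝓝 0)} := by
  rw [← isSeqClosed_iff_isClosed]
  intro u x hu hx
  simp only [Set.mem_setOf_eq] at hu ⊢
  rw [Metric.tendsto_nhds]
  intro ε hε
  obtain ⟨N, hN⟩ := (Metric.tendsto_nhds.1 hx (ε / (2 * C)) (by positivity)).exists
  filter_upwards [Metric.tendsto_nhds.1 (hu N) (ε / 2) (by positivity)] with i hi
  rw [dist_zero_right] at hi ⊢
  have h1 : H i x = H i (u N) - H i (u N - x) := by simp
  have h2 := hH i (u N - x)
  rw [dist_eq_norm] at hN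
  have h3 : C * ‖u N - x‖ < ε / 2 := by
    have := mul_lt_mul_of_pos_left hN hC
    calc _ < _ := this
      _ = ε / 2 := by field_simp
  rw [h1]
  have := norm_sub_le (H i (u N)) (H i (u N - x))
  linarith

/-- Induction on words for the star algebra generated by a set. -/
theorem adjoin_word_induction {s : Set A} {p : A → Prop} (one : p 1)
    (mul : ∀ c, (c ∈ s ∨ star c ∈ s) → ∀ y, p y → p (c * y)) {x : A}
    (hx : x ∈ StarAlgebra.adjoin ℂ s) : x ∈ Submodule.span ℂ {y | p y} := by
  have h : x ∈ Subalgebra.toSubmodule (StarAlgebra.adjoin ℂ s).toSubalgebra := hx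
  rw [StarAlgebra.adjoin_eq_span] at h
  refine Submodule.span_mono ?_ h
  intro y hy
  refine Submonoid.closure_induction_left (motive := fun m _ => p m) one ?_ hy
  intro c hc y _ hy
  exact mul c hc y hy

/-! ### (ii) implies (i) -/

theorem clustering_aux {φ ψ : A →ₗ[ℂ] ℂ} (hφ : IsState φ) (hψ : IsState ψ) (C : ℝ) (hC : 0 < C)
    (hle : ∀ z, (ψ (star z * z)).re ≤ C * (φ (star z * z)).re)
    (x : A) (v : ℕ → A) (hv : ∀ y, Tendsto (fun n => φ (star (v n) * y)) atTop (𝓝 0))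
    (K : ℝ) (hK : ∀ n, (φ (star (v n) * v n)).re ≤ K) (hψv : ∀ n, ψ (v n) = ψ x) : ψ x = 0 := by
  have key : ∀ N : ℕ, ∃ Y : A, (φ (star Y * Y)).re ≤ N * (K + 1) ∧ ψ Y = N * ψ x := by
    intro N
    induction N with
    | zero => exact ⟨0, by simp, by simp⟩
    | succ N ih =>
      obtain ⟨Y, h1, h2⟩ := ih
      obtain ⟨n, hn⟩ := (Metric.tendsto_nhds.1 (hv Y) (1 / 2) (by norm_num)).exists
      rw [dist_zero_right] at hn
      refine ⟨Y + v n, ?_, ?_⟩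
      · have e1 : star (Y + v n) * (Y + v n)
            = star Y * Y + star Y * v n + star (v n) * Y + star (v n) * v n := by
          rw [star_add]; noncomm_ring
        have e2 : φ (star Y * v n) = star (φ (star (v n) * Y)) := by
          rw [← hφ.exists_pos_s9.2]; simp
        have e3 : (star (φ (star (v n) * Y))).re = (φ (star (v n) * Y)).re := rfl
        have e4 := (Complex.re_le_norm (φ (star (v n) * Y)))
        have e5 := hK n
        rw [e1, map_add, map_add, map_add, e2, Complex.add_re, Complex.add_re, Complex.add_re, e3]
        push_cast
        linarith
      · rw [map_add, h2, hψv]; push_cast; ring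
  by_contra hne
  have hpos : 0 < ‖ψ x‖ := norm_pos_iff.2 hne
  obtain ⟨N, hN⟩ := exists_nat_gt (C * (K + 1) / ‖ψ x‖ ^ 2)
  have hN' : C * (K + 1) / ‖ψ x‖ ^ 2 < (N + 1 : ℕ) := hN.trans (by push_cast; linarith)
  rw [div_lt_iff₀ (by positivity)] at hN'
  obtain ⟨Y, h1, h2⟩ := key (N + 1)
  have h3 := hψ.cauchy_schwarz_one Y
  have h4 := hle Y
  rw [h2, norm_mul, Complex.norm_natCast] at h3
  have h5 : C * (φ (star Y * Y)).re ≤ C * ((N + 1 : ℕ) * (K + 1)) := by gcongr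
  have h6 : (0 : ℝ) < (N + 1 : ℕ) := by positivity
  have h7 := mul_lt_mul_of_pos_left hN' h6
  nlinarith

theorem gswap_finite (n : ℕ) : IsFinitePerm (gswap n) := by
  apply (Set.finite_lt_nat (2 * 2 ^ (n - 1))).subset
  intro j hj
  by_contra h
  apply hj
  simp only [Set.mem_setOf_eq, not_lt] at h
  change halfSwapFun _ j = j
  unfold halfSwapFun
  split_ifs <;> omega

theorem extreme_of_clustering_s9 (α : Equiv.Perm ℕ → (A ≃⋆ₐ[ℂ] A))
    (φ : A →ₗ[ℂ] ℂ) (hφ : φ ∈ SymmetricStates α)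
    (hc : ∀ x y : A, Tendsto (fun n : ℕ => φ (α (gswap n) x * y)) atTop (𝓝 (φ x * φ y))) :
    φ ∈ Set.extremePoints ℝ (SymmetricStates α) := by
  rw [mem_extremePoints_iff_left]
  refine ⟨hφ, ?_⟩
  rintro ψ hψ χ hχ ⟨s, t, hs, ht, hst, rfl⟩
  set φ := s • ψ + t • χ with hφdef
  have hzero : ∀ x, φ x = 0 → ψ x = 0 := by
    intro x hx
    refine clustering_aux hφ.1 hψ.1 s⁻¹ (by positivity) ?_ x (fun n => α (gswap n) x) ?_
      (φ (star x * x)).re ?_ ?_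
    · intro z
      have h1 := (Complex.nonneg_iff.1 (hχ.1.2 z)).1
      have h2 : (φ (star z * z)).re = s * (ψ (star z * z)).re + t * (χ (star z * z)).re := by
        simp [hφdef]
      rw [h2, mul_add, inv_mul_cancel_left₀ hs.ne']
      have : 0 ≤ s⁻¹ * (t * (χ (star z * z)).re) := by positivity
      linarith
    · intro y
      have := hc (star x) y
      rw [hφ.1.exists_pos_s9.2, hx] at this
      simpa [map_star] using this
    · intro n
      rw [← map_star, ← map_mul, hφ.2 _ (gswap_finite n)]
    · intro n
      exact hψ.2 _ (gswap_finite n) x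
  ext x
  have := hzero (x - φ x • 1) (by simp [hφ.1.1])
  rw [map_sub, map_smul, hψ.1.1, smul_eq_mul, mul_one, sub_eq_zero] at this
  exact this

/-! ### One-site algebras -/

/-- Elements of the linear span of `1, a_j* a_j, a_j, a_j*`. -/
def SiteElt (a : ℕ → A) (j : ℕ) (x : A) : Prop :=
  ∃ s t u v : ℂ, x = s • (1 : A) + t • (star (a j) * a j) + u • a j + v • star (a j)

theorem car_sq {a : ℕ → A} (ha : IsCARFamily a) (j : ℕ) : a j * a j = 0 := by
  have h := ha.2.2.1 j j
  rw [← two_smul ℂ] at h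
  exact (smul_eq_zero.1 h).resolve_left two_ne_zero

theorem car_sq_star {a : ℕ → A} (ha : IsCARFamily a) (j : ℕ) : star (a j) * star (a j) = 0 := by
  rw [← star_mul, car_sq ha, star_zero]

theorem car_mul_star {a : ℕ → A} (ha : IsCARFamily a) (j : ℕ) :
    a j * star (a j) = 1 - star (a j) * a j := by
  rw [← ha.1 j]; abel

theorem car_anti {a : ℕ → A} (ha : IsCARFamily a) {i j : ℕ} (hij : i ≠ j) {c : A}
    (hc : c = a j ∨ star c = a j) : c * a i = -(a i * c) ∧ c * star (a i) = -(star (a i) * c) := by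
  rcases hc with rfl | hc
  · constructor
    · exact eq_neg_of_add_eq_zero_left (ha.2.2.1 j i)
    · exact eq_neg_of_add_eq_zero_right (ha.2.1 i j hij)
  · obtain rfl : c = star (a j) := by rw [← hc, star_star]
    constructor
    · exact eq_neg_of_add_eq_zero_left (ha.2.1 j i hij.symm)
    · have := congrArg star (eq_neg_of_add_eq_zero_left (ha.2.2.1 i j))
      simpa [star_mul, star_neg] using this

theorem siteElt_one (a : ℕ → A) (j : ℕ) : SiteElt a j 1 := ⟨1, 0, 0, 0, by simp⟩

theorem siteElt_gen_mul {a : ℕ → A} (ha : IsCARFamily a) {j : ℕ} {c x : A}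
    (hc : c = a j ∨ star c = a j) (hx : SiteElt a j x) : SiteElt a j (c * x) := by
  obtain ⟨s, t, u, v, rfl⟩ := hx
  rcases hc with rfl | hc
  · refine ⟨v, -v, s + t, 0, ?_⟩
    have h1 : a j * (star (a j) * a j) = a j := by
      rw [← mul_assoc, car_mul_star ha, sub_mul, mul_assoc, car_sq ha]; simp
    simp only [mul_add, mul_smul_comm, h1, car_sq ha, car_mul_star ha, mul_one]
    module
  · obtain rfl : c = star (a j) := by rw [← hc, star_star]
    refine ⟨0, u, 0, s, ?_⟩
    have h1 : star (a j) * (star (a j) * a j) = 0 := by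
      rw [← mul_assoc, car_sq_star ha, zero_mul]
    simp only [mul_add, mul_smul_comm, h1, car_sq_star ha, mul_one]
    module

theorem siteElt_gen {a : ℕ → A} (ha : IsCARFamily a) {j : ℕ} {c : A}
    (hc : c = a j ∨ star c = a j) : SiteElt a j c := by
  simpa using siteElt_gen_mul ha hc (siteElt_one a j)

theorem siteElt_anti {a : ℕ → A} (ha : IsCARFamily a) {i j : ℕ} (hij : i ≠ j) {c x : A}
    (hc : c = a j ∨ star c = a j) (hx : SiteElt a i x) :
    ∃ x', SiteElt a i x' ∧ c * x = x' * c := by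
  obtain ⟨s, t, u, v, rfl⟩ := hx
  obtain ⟨h1, h2⟩ := car_anti ha hij hc
  refine ⟨_, ⟨s, t, -u, -v, rfl⟩, ?_⟩
  have h3 : c * (star (a i) * a i) = star (a i) * a i * c := by
    rw [← mul_assoc, h2, neg_mul, mul_assoc, h1, mul_neg, neg_neg, mul_assoc]
  simp only [mul_add, add_mul, mul_smul_comm, smul_mul_assoc, h1, h2, h3, mul_one, one_mul]
  module

theorem siteElt_mem_adjoin {a : ℕ → A} {j : ℕ} {x : A} (hx : SiteElt a j x) :
    x ∈ StarAlgebra.adjoin ℂ ({a j} : Set A) := by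
  obtain ⟨s, t, u, v, rfl⟩ := hx
  have h : a j ∈ StarAlgebra.adjoin ℂ ({a j} : Set A) :=
    StarAlgebra.subset_adjoin ℂ _ (Set.mem_singleton _)
  exact add_mem (add_mem (add_mem (SMulMemClass.smul_mem _ (one_mem _))
    (SMulMemClass.smul_mem _ (mul_mem (star_mem h) h))) (SMulMemClass.smul_mem _ h))
    (SMulMemClass.smul_mem _ (star_mem h))

/-- The span of the one-site elements, as a submodule. -/
noncomputable def siteSpan (a : ℕ → A) (j : ℕ) : Submodule ℂ A :=
  Submodule.span ℂ (Set.range ![(1 : A), star (a j) * a j, a j, star (a j)])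

theorem mem_siteSpan {a : ℕ → A} {j : ℕ} {x : A} : x ∈ siteSpan a j ↔ SiteElt a j x := by
  unfold siteSpan SiteElt
  rw [Submodule.mem_span_range_iff_exists_fun]
  constructor
  · rintro ⟨c, rfl⟩
    exact ⟨c 0, c 1, c 2, c 3, by simp [Fin.sum_univ_four]⟩
  · rintro ⟨s, t, u, v, rfl⟩
    exact ⟨![s, t, u, v], by simp [Fin.sum_univ_four]⟩

theorem siteElt_of_mem_closure {a : ℕ → A} (ha : IsCARFamily a) {j : ℕ} {x : A}
    (hx : x ∈ (StarAlgebra.adjoin ℂ ({a j} : Set A)).topologicalClosure) : SiteElt a j x := by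
  have h1 : ∀ y ∈ StarAlgebra.adjoin ℂ ({a j} : Set A), y ∈ siteSpan a j := by
    intro y hy
    have := adjoin_word_induction (p := SiteElt a j) (siteElt_one a j)
      (fun c hc y hy => siteElt_gen_mul ha (by simpa using hc) hy) hy
    refine Submodule.span_le.2 ?_ this
    intro z hz
    exact mem_siteSpan.2 hz
  have h2 : IsClosed (siteSpan a j : Set A) := by
    haveI : FiniteDimensional ℂ (siteSpan a j) :=
      FiniteDimensional.span_of_finite ℂ (Set.finite_range _)
    exact Submodule.closed_of_finiteDimensional _
  have h3 : x ∈ closure (StarAlgebra.adjoin ℂ ({a j} : Set A) : Set A) := hx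
  exact mem_siteSpan.1 (closure_minimal (fun y hy => h1 y hy) h2 h3)

theorem siteElt_map {a : ℕ → A} {g : A ≃⋆ₐ[ℂ] A} {j k : ℕ} (hg : g (a j) = a k) {x : A}
    (hx : SiteElt a j x) : SiteElt a k (g x) := by
  obtain ⟨s, t, u, v, rfl⟩ := hx
  exact ⟨s, t, u, v, by simp [hg, map_star]⟩

theorem siteElt_fixed {a : ℕ → A} {g : A ≃⋆ₐ[ℂ] A} {j : ℕ} (hg : g (a j) = a j) {x : A}
    (hx : SiteElt a j x) : g x = x := by
  obtain ⟨s, t, u, v, rfl⟩ := hx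
  simp [hg, map_star]

/-! ### Products over finite sets of sites -/

/-- Products of one-site elements at the distinct sites of a finite set, in some order. -/
inductive IsProdOver (a : ℕ → A) : Finset ℕ → A → Prop
  | one : IsProdOver a ∅ 1
  | cons {S : Finset ℕ} {j : ℕ} {x y : A} (hj : j ∉ S) (hx : SiteElt a j x)
      (hy : IsProdOver a S y) : IsProdOver a (insert j S) (x * y)

theorem IsProdOver.gen_mul {a : ℕ → A} (ha : IsCARFamily a) {j : ℕ} {c : A}
    (hc : c = a j ∨ star c = a j) {S : Finset ℕ} {y : A} (hy : IsProdOver a S y) (hj : j ∈ S) :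
    IsProdOver a S (c * y) := by
  induction hy with
  | one => simp at hj
  | @cons S i x y hi hx hy ih =>
    by_cases hij : i = j
    · subst hij
      rw [← mul_assoc]
      exact IsProdOver.cons hi (siteElt_gen_mul ha hc hx) hy
    · obtain ⟨x', hx', h⟩ := siteElt_anti ha hij hc hx
      rw [← mul_assoc, h, mul_assoc]
      refine IsProdOver.cons hi hx' (ih ?_)
      rcases Finset.mem_insert.1 hj with h | h
      · exact absurd h.symm hij
      · exact h

theorem mem_span_isProdOver {a : ℕ → A} (ha : IsCARFamily a) {x : A}
    (hx : x ∈ StarAlgebra.adjoin ℂ (Set.range a)) :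
    x ∈ Submodule.span ℂ {y | ∃ S, IsProdOver a S y} := by
  refine adjoin_word_induction (p := fun y => ∃ S, IsProdOver a S y) ⟨_, IsProdOver.one⟩ ?_ hx
  rintro c hc y ⟨S, hy⟩
  obtain ⟨j, hj⟩ : ∃ j, c = a j ∨ star c = a j := by
    rcases hc with ⟨j, h⟩ | ⟨j, h⟩
    · exact ⟨j, Or.inl h.symm⟩
    · exact ⟨j, Or.inr h.symm⟩
  by_cases hjS : j ∈ S
  · exact ⟨S, hy.gen_mul ha hj hjS⟩
  · exact ⟨_, IsProdOver.cons hjS (siteElt_gen ha hj) hy⟩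

theorem IsProdOver.map {a : ℕ → A} {g : A ≃⋆ₐ[ℂ] A} {σ : Equiv.Perm ℕ}
    (hg : ∀ j, g (a j) = a (σ j)) {S : Finset ℕ} {y : A} (hy : IsProdOver a S y) :
    IsProdOver a (S.map σ.toEmbedding) (g y) := by
  induction hy with
  | one => simpa using IsProdOver.one
  | @cons S i x y hi hx hy ih =>
    rw [map_mul, Finset.map_insert]
    exact IsProdOver.cons (by simpa using hi) (siteElt_map (hg i) hx) ih

theorem IsProdOver.fixed {a : ℕ → A} {g : A ≃⋆ₐ[ℂ] A} {S : Finset ℕ} {y : A}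
    (hy : IsProdOver a S y) (hg : ∀ j ∈ S, g (a j) = a j) : g y = y := by
  induction hy with
  | one => simp
  | @cons S i x y hi hx hy ih =>
    rw [map_mul, siteElt_fixed (hg i (by simp)) hx, ih (fun j hj => hg j (by simp [hj]))]

theorem IsProdOver.mul {a : ℕ → A} {S T : Finset ℕ} {x y : A} (hx : IsProdOver a S x)
    (hy : IsProdOver a T y) (h : Disjoint S T) : IsProdOver a (S ∪ T) (x * y) := by
  induction hx with
  | one => simpa using hy
  | @cons S i x z hi hx hz ih =>
    rw [Finset.disjoint_insert_left] at h
    rw [Finset.insert_union, mul_assoc]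
    exact IsProdOver.cons (by simp [hi, h.1]) hx (ih h.2)

theorem IsProdOver.exists_ofFn {a : ℕ → A} {S : Finset ℕ} {y : A} (hy : IsProdOver a S y) :
    ∃ (m : ℕ) (j : Fin m → ℕ) (x : Fin m → A), Function.Injective j ∧ (∀ k, j k ∈ S) ∧
      (∀ k, SiteElt a (j k) (x k)) ∧ y = (List.ofFn x).prod := by
  induction hy with
  | one => exact ⟨0, Fin.elim0, Fin.elim0, fun i => i.elim0, fun i => i.elim0,
      fun i => i.elim0, by simp⟩
  | @cons S i x y hi hx hy ih =>
    obtain ⟨m, j, z, h1, h2, h3, h4⟩ := ih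
    refine ⟨m + 1, Fin.cons i j, Fin.cons x z, ?_, ?_, ?_, ?_⟩
    · rw [Fin.cons_injective_iff]
      refine ⟨?_, h1⟩
      rintro ⟨k, rfl⟩
      exact hi (h2 k)
    · intro k
      refine Fin.cases ?_ (fun k => ?_) k
      · simp
      · simp [h2 k]
    · intro k
      refine Fin.cases ?_ (fun k => ?_) k
      · simpa using hx
      · simpa using h3 k
    · rw [List.ofFn_succ, List.prod_cons, h4]
      simp

theorem isProdOver_ofFn {a : ℕ → A} (m : ℕ) (j : Fin m → ℕ) (x : Fin m → A)
    (hj : Function.Injective j) (hx : ∀ k, SiteElt a (j k) (x k)) :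
    IsProdOver a (Finset.univ.image j) (List.ofFn x).prod := by
  induction m with
  | zero => simpa using IsProdOver.one
  | succ m ih =>
    have := IsProdOver.cons (a := a) (S := Finset.univ.image fun k => j (Fin.succ k)) (j := j 0)
      (by
        simp only [Finset.mem_image, Finset.mem_univ, true_and, not_exists]
        intro k hk
        exact Fin.succ_ne_zero k (hj hk)) (hx 0)
      (ih (fun k => j k.succ) (fun k => x k.succ)
        (fun k l h => Fin.succ_injective _ (hj h)) (fun k => hx k.succ))
    rw [List.ofFn_succ, List.prod_cons]
    convert this using 1
    ext n
    simp [Fin.exists_fin_succ, eq_comm]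

/-- It suffices to split off one site at a time. -/
theorem isProductState_iff {a : ℕ → A} (ha : IsCARFamily a) {φ : A →ₗ[ℂ] ℂ} (h1 : φ 1 = 1) :
    IsProductState a φ ↔ ∀ (S : Finset ℕ) (j : ℕ) (x y : A), j ∉ S → SiteElt a j x →
      IsProdOver a S y → φ (x * y) = φ x * φ y := by
  constructor
  · intro h S j x y hj hx hy
    obtain ⟨m, k, z, hk, hkS, hz, rfl⟩ := hy.exists_ofFn
    have hz' : ∀ i, z i ∈ (StarAlgebra.adjoin ℂ ({a (k i)} : Set A)).topologicalClosure :=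
      fun i => StarSubalgebra.le_topologicalClosure _ (siteElt_mem_adjoin (hz i))
    rw [h m k hk z hz']
    have := h (m + 1) (Fin.cons j k) (by
      rw [Fin.cons_injective_iff]
      refine ⟨?_, hk⟩
      rintro ⟨k, rfl⟩
      exact hj (hkS k)) (Fin.cons x z) (by
      intro i
      refine Fin.cases ?_ (fun i => ?_) i
      · simpa using StarSubalgebra.le_topologicalClosure _ (siteElt_mem_adjoin hx)
      · simpa using hz' i)
    rw [List.ofFn_succ, List.prod_cons, Fin.prod_univ_succ] at this
    simpa using this
  · intro h m
    induction m with
    | zero => intro j _ x _; simp [h1]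
    | succ m ih =>
      intro j hj x hx
      have hj' : Function.Injective (fun k : Fin m => j k.succ) :=
        fun k l h => Fin.succ_injective _ (hj h)
      rw [List.ofFn_succ, List.prod_cons, Fin.prod_univ_succ,
        ← ih (fun k => j k.succ) hj' (fun k => x k.succ) (fun k => hx k.succ)]
      refine h _ (j 0) _ _ ?_ (siteElt_of_mem_closure ha (hx 0))
        (isProdOver_ofFn m (fun k => j k.succ) (fun k => x k.succ) hj'
          (fun k => siteElt_of_mem_closure ha (hx k.succ)))
      simp only [Finset.mem_image, Finset.mem_univ, true_and, not_exists]
      intro k hk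
      exact Fin.succ_ne_zero k (hj hk)

/-! ### (iii) implies (ii) -/

theorem clustering_of_product (a : ℕ → A) (ha : IsCARFamily a)
    (α : Equiv.Perm ℕ → (A ≃⋆ₐ[ℂ] A))
    (hα : ∀ g : Equiv.Perm ℕ, IsFinitePerm g → ∀ j : ℕ, α g (a j) = a (g j))
    (φ : A →ₗ[ℂ] ℂ) (hφ : φ ∈ SymmetricStates α) (hp : IsProductState a φ) (x y : A) :
    Tendsto (fun n : ℕ => φ (α (gswap n) x * y)) atTop (𝓝 (φ x * φ y)) := by
  rw [isProductState_iff ha hφ.1.1] at hp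
  obtain ⟨C, hC, hb⟩ := hφ.1.exists_pos_s9.1
  have hp2 : ∀ (S T : Finset ℕ) (x y : A), Disjoint S T → IsProdOver a S x → IsProdOver a T y →
      φ (x * y) = φ x * φ y := by
    intro S T x y hST hx hy
    induction hx with
    | one => simp [hφ.1.1]
    | @cons S i x z hi hx hz ih =>
      rw [Finset.disjoint_insert_left] at hST
      rw [mul_assoc, hp (S ∪ T) i x (z * y) (by simp [hi, hST.1]) hx (hz.mul hy hST.2),
        ih hST.2, hp S i x z hi hx hz, mul_assoc]
  -- the difference as bounded additive maps
  let H : A → ℕ → A →+ ℂ := fun y n => AddMonoidHom.mk' (fun x => φ (α (gswap n) x * y) - φ x * φ y)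
    (by intro x z; simp only [map_add, add_mul]; ring)
  let H' : A → ℕ → A →+ ℂ := fun x n => AddMonoidHom.mk' (fun y => φ (α (gswap n) x * y) - φ x * φ y)
    (by intro y z; simp only [map_add, mul_add]; ring)
  have hbound : ∀ x y n, ‖φ (α (gswap n) x * y) - φ x * φ y‖ ≤ (C + C * C) * ‖x‖ * ‖y‖ := by
    intro x y n
    have h1 := hb (α (gswap n) x * y)
    have h2 := norm_mul_le (α (gswap n) x) y
    rw [norm_auto_apply] at h2
    have h3 : ‖φ x * φ y‖ ≤ (C * ‖x‖) * (C * ‖y‖) := by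
      rw [norm_mul]
      exact mul_le_mul (hb x) (hb y) (norm_nonneg _) (by positivity)
    have h4 := norm_sub_le (φ (α (gswap n) x * y)) (φ x * φ y)
    have h5 := mul_le_mul_of_nonneg_left h2 hC.le
    linarith
  have hcl : ∀ y, IsClosed {x | Tendsto (fun n => H y n x) atTop (𝓝 0)} := by
    intro y
    refine isClosed_tendsto_zero atTop (H y) ((C + C * C) * (‖y‖ + 1)) (by positivity) ?_
    intro n x
    refine (hbound x y n).trans ?_
    have : 0 ≤ (C + C * C) * ‖x‖ := by positivity
    nlinarith
  have hcl' : ∀ x, IsClosed {y | Tendsto (fun n => H' x n y) atTop (𝓝 0)} := by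
    intro x
    refine isClosed_tendsto_zero atTop (H' x) ((C + C * C) * (‖x‖ + 1)) (by positivity) ?_
    intro n y
    refine (hbound x y n).trans ?_
    have : 0 ≤ (C + C * C) * ‖y‖ := by positivity
    nlinarith
  let W : Submodule ℂ A := Submodule.span ℂ {y | ∃ S, IsProdOver a S y}
  have hdense : ∀ x : A, x ∈ closure (W : Set A) := by
    intro x
    have h : x ∈ (StarAlgebra.adjoin ℂ (Set.range a)).topologicalClosure := by
      rw [ha.2.2.2]; trivial
    exact closure_mono (fun y hy => mem_span_isProdOver ha hy) h
  have hloc : ∀ x ∈ W, ∀ y ∈ W,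
      Tendsto (fun n : ℕ => φ (α (gswap n) x * y) - φ x * φ y) atTop (𝓝 0) := by
    intro x hx y hy
    induction hx using Submodule.span_induction with
    | zero => simp
    | add x z _ _ h1 h2 =>
      have := h1.add h2
      simp only [add_zero] at this
      refine this.congr fun n => ?_
      simp only [map_add, add_mul]; ring
    | smul c x _ h1 =>
      have := h1.const_mul c
      simp only [mul_zero] at this
      refine this.congr fun n => ?_
      simp only [map_smul, smul_mul_assoc, smul_eq_mul]; ring
    | mem x hx =>
    induction hy using Submodule.span_induction with
    | zero => simp
    | add x z _ _ h1 h2 =>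
      have := h1.add h2
      simp only [add_zero] at this
      refine this.congr fun n => ?_
      simp only [map_add, mul_add]; ring
    | smul c x _ h1 =>
      have := h1.const_mul c
      simp only [mul_zero] at this
      refine this.congr fun n => ?_
      simp only [map_smul, mul_smul_comm, smul_eq_mul]; ring
    | mem y hy =>
    obtain ⟨S, hS⟩ := hx
    obtain ⟨T, hT⟩ := hy
    refine tendsto_const_nhds.congr' ?_
    obtain ⟨M, hM⟩ := (S ∪ T).bddAbove
    filter_upwards [eventually_ge_atTop (M + 2)] with n hn
    symm
    rw [sub_eq_zero, hp2 _ _ _ _ ?_ (hS.map (hα _ (gswap_finite n))) hT, hφ.2 _ (gswap_finite n)]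
    rw [Finset.disjoint_left]
    intro k hk hkT
    rw [Finset.mem_map] at hk
    obtain ⟨i, hi, rfl⟩ := hk
    have h1 : i ≤ M := hM (by simp [hi])
    have h2 : halfSwapFun (2 ^ (n - 1)) i ≤ M := hM (by
      have : halfSwapFun (2 ^ (n - 1)) i ∈ T := hkT
      simp [this])
    have h3 : n - 1 < 2 ^ (n - 1) := Nat.lt_two_pow_self
    unfold halfSwapFun at h2
    split_ifs at h2 <;> omega
  have step : ∀ y ∈ W, ∀ x, Tendsto (fun n => H y n x) atTop (𝓝 0) := by
    intro y hy x
    exact closure_minimal (fun x hx => hloc x hx y hy) (hcl y) (hdense x)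
  have step2 : Tendsto (fun n => H' x n y) atTop (𝓝 0) :=
    closure_minimal (fun y hy => step y hy x) (hcl' x) (hdense y)
  have := step2.add_const (φ x * φ y)
  rw [zero_add] at this
  refine this.congr fun n => ?_
  change φ (α (gswap n) x * y) - φ x * φ y + φ x * φ y = _
  ring

/-! ### (i) implies (iii) -/

theorem swap_finite (j k : ℕ) : IsFinitePerm (Equiv.swap j k) := by
  apply (Set.toFinite {j, k}).subset
  intro i hi
  by_contra h
  simp only [Set.mem_insert_iff, Set.mem_singleton_iff, not_or] at h
  exact hi (Equiv.swap_apply_of_ne_of_ne h.1 h.2)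

theorem swap_indep (a : ℕ → A)
    (α : Equiv.Perm ℕ → (A ≃⋆ₐ[ℂ] A))
    (hα : ∀ g : Equiv.Perm ℕ, IsFinitePerm g → ∀ j : ℕ, α g (a j) = a (g j))
    (φ : A →ₗ[ℂ] ℂ) (hφ : φ ∈ SymmetricStates α) (c : ℕ → A)
    (hc : ∀ g : Equiv.Perm ℕ, IsFinitePerm g → ∀ j : ℕ, α g (c j) = c (g j))
    {S : Finset ℕ} {y : A} (hy : IsProdOver a S y) {j k : ℕ} (hj : j ∉ S) (hk : k ∉ S) :
    φ (c k * y) = φ (c j * y) := by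
  rw [← hφ.2 (Equiv.swap j k) (swap_finite j k) (c j * y), map_mul (α _), hc _ (swap_finite j k),
    Equiv.swap_apply_left, hy.fixed]
  intro i hi
  rw [hα _ (swap_finite j k), Equiv.swap_apply_of_ne_of_ne]
  · rintro rfl; exact hj hi
  · rintro rfl; exact hk hi

/-- Odd elements have vanishing expectations. -/
theorem odd_vanish (a : ℕ → A)
    (α : Equiv.Perm ℕ → (A ≃⋆ₐ[ℂ] A))
    (hα : ∀ g : Equiv.Perm ℕ, IsFinitePerm g → ∀ j : ℕ, α g (a j) = a (g j))
    (φ : A →ₗ[ℂ] ℂ) (hφ : φ ∈ SymmetricStates α) (c : ℕ → A)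
    (hc : ∀ g : Equiv.Perm ℕ, IsFinitePerm g → ∀ j : ℕ, α g (c j) = c (g j))
    (hanti : ∀ j k, c j * star (c k) + star (c k) * c j = if j = k then 1 else 0)
    {S : Finset ℕ} {y : A} (hy : IsProdOver a S y) {j : ℕ} (hj : j ∉ S) :
    φ (c j * y) = 0 := by
  obtain ⟨M, hM⟩ := S.bddAbove
  have hkS : ∀ i, M + 1 + i ∉ S := by
    intro i hi
    have := hM hi
    omega
  let X : ℕ → A := fun N => ∑ i ∈ Finset.range N, c (M + 1 + i)
  have h1 : ∀ N, φ (X N * y) = N * φ (c j * y) := by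
    intro N
    simp only [X, Finset.sum_mul, map_sum]
    rw [Finset.sum_congr rfl fun i _ => swap_indep a α hα φ hφ c hc hy hj (hkS i)]
    simp
  have h2 : ∀ N, X N * star (X N) + star (X N) * X N = (N : ℂ) • 1 := by
    intro N
    simp only [X, star_sum, Finset.sum_mul_sum]
    rw [Finset.sum_comm (s := Finset.range N) (t := Finset.range N)
      (f := fun i k => star (c (M + 1 + i)) * c (M + 1 + k)), ← Finset.sum_add_distrib]
    simp_rw [← Finset.sum_add_distrib, hanti]
    have : ∀ i ∈ Finset.range N, (∑ k ∈ Finset.range N,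
        if M + 1 + i = M + 1 + k then (1 : A) else 0) = 1 := by
      intro i hi
      simp only [Nat.add_left_cancel_iff, Finset.sum_ite_eq, hi, if_true]
    rw [Finset.sum_congr rfl this, Finset.sum_const, Finset.card_range, Nat.cast_smul_eq_nsmul]
  have h3 : ∀ N : ℕ, (φ (X N * star (X N))).re ≤ N := by
    intro N
    have := congrArg (fun z => (φ z).re) (h2 N)
    simp only [map_add, map_smul, hφ.1.1, Complex.add_re] at this
    have h4 := (Complex.nonneg_iff.1 (hφ.1.2 (X N))).1
    simp at this
    linarith
  by_contra hne
  have hpos : 0 < ‖φ (c j * y)‖ := norm_pos_iff.2 hne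
  have hy0 := (Complex.nonneg_iff.1 (hφ.1.2 y)).1
  obtain ⟨N, hN⟩ := exists_nat_gt ((φ (star y * y)).re / ‖φ (c j * y)‖ ^ 2)
  rw [div_lt_iff₀ (by positivity)] at hN
  have hN0 : (0 : ℝ) < N := by
    by_contra h
    have : (N : ℝ) = 0 := le_antisymm (not_lt.1 h) (Nat.cast_nonneg N)
    rw [this] at hN
    linarith
  have h5 := hφ.1.cauchy_schwarz (star (X N)) y
  rw [star_star, h1, norm_mul, Complex.norm_natCast] at h5
  have h6 := mul_le_mul_of_nonneg_right (h3 N) hy0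
  have h7 := mul_lt_mul_of_pos_left hN hN0
  nlinarith

theorem num_star (a : ℕ → A) (k : ℕ) : star (star (a k) * a k) = star (a k) * a k := by simp

theorem num_idem {a : ℕ → A} (ha : IsCARFamily a) (k : ℕ) :
    (star (a k) * a k) * (star (a k) * a k) = star (a k) * a k := by
  have h1 : a k * (star (a k) * a k) = a k := by
    rw [← mul_assoc, car_mul_star ha, sub_mul, mul_assoc, car_sq ha]; simp
  rw [mul_assoc, h1]

theorem num_norm {a : ℕ → A} (ha : IsCARFamily a) (k : ℕ) : ‖star (a k) * a k‖ ≤ 1 := by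
  have h := CStarRing.norm_star_mul_self (x := star (a k) * a k)
  rw [num_star, num_idem ha] at h
  by_contra h1
  push Not at h1
  nlinarith

/-- The number operators asymptotically commute with everything. -/
theorem num_commute {a : ℕ → A} (ha : IsCARFamily a) (y : A) :
    Tendsto (fun k => star (a k) * a k * y - y * (star (a k) * a k)) atTop (𝓝 0) := by
  have hcl : IsClosed {y : A | Tendsto (fun k => star (a k) * a k * y - y * (star (a k) * a k))
      atTop (𝓝 0)} := by
    refine isClosed_tendsto_zero atTop (fun k => AddMonoidHom.mk'
      (fun y : A => star (a k) * a k * y - y * (star (a k) * a k))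
      (by intro y z; simp only [mul_add, add_mul]; abel)) 2 two_pos ?_
    intro k y
    have h0 := num_norm ha k
    have h1 := norm_sub_le (star (a k) * a k * y) (y * (star (a k) * a k))
    have h2 := norm_mul_le (star (a k) * a k) y
    have h3 := norm_mul_le y (star (a k) * a k)
    have h4 := norm_nonneg y
    change ‖star (a k) * a k * y - y * (star (a k) * a k)‖ ≤ _
    nlinarith
  let T : StarSubalgebra ℂ A :=
    { carrier := {y : A | Tendsto (fun k => star (a k) * a k * y - y * (star (a k) * a k))
        atTop (𝓝 0)}
      mul_mem' := by
        intro x y hx hy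
        have h1 := (hx.mul_const y).add (Tendsto.const_mul x hy)
        simp only [zero_mul, mul_zero, add_zero] at h1
        refine h1.congr fun k => ?_
        noncomm_ring
      add_mem' := by
        intro x y hx hy
        have h1 := Tendsto.add hx hy
        simp only [add_zero] at h1
        refine h1.congr fun k => ?_
        noncomm_ring
      algebraMap_mem' := by
        intro r
        refine tendsto_const_nhds.congr fun k => ?_
        rw [Algebra.commutes r, sub_self]
      star_mem' := by
        intro x hx
        have h1 := (Tendsto.star hx).neg
        simp only [star_zero, neg_zero] at h1
        refine h1.congr fun k => ?_
        simp }
  have hle : (StarAlgebra.adjoin ℂ (Set.range a)).topologicalClosure ≤ T := by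
    refine StarSubalgebra.topologicalClosure_minimal (StarAlgebra.adjoin_le ?_) hcl
    rintro _ ⟨j, rfl⟩
    refine tendsto_const_nhds.congr' ?_
    filter_upwards [eventually_gt_atTop j] with k hk
    obtain ⟨h1, h2⟩ := car_anti ha (i := k) (j := j) hk.ne' (c := a j) (Or.inl rfl)
    rw [← mul_assoc, h2, neg_mul, mul_assoc, mul_assoc, h1, mul_neg, neg_neg, sub_self]
  rw [ha.2.2.2] at hle
  exact hle (show y ∈ (⊤ : StarSubalgebra ℂ A) from trivial)

theorem num_factor (a : ℕ → A) (ha : IsCARFamily a)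
    (α : Equiv.Perm ℕ → (A ≃⋆ₐ[ℂ] A))
    (hα : ∀ g : Equiv.Perm ℕ, IsFinitePerm g → ∀ j : ℕ, α g (a j) = a (g j))
    (φ : A →ₗ[ℂ] ℂ) (hφ : φ ∈ Set.extremePoints ℝ (SymmetricStates α))
    {S : Finset ℕ} {y : A} (hy : IsProdOver a S y) {j : ℕ} (hj : j ∉ S) :
    φ (star (a j) * a j * y) = φ (star (a j) * a j) * φ y := by
  rw [mem_extremePoints_iff_left] at hφ
  obtain ⟨hφ, hext⟩ := hφ
  obtain ⟨C, hC, hb⟩ := hφ.1.exists_pos_s9.1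
  let c : ℕ → A := fun k => star (a k) * a k
  have hcα : ∀ g : Equiv.Perm ℕ, IsFinitePerm g → ∀ j : ℕ, α g (c j) = c (g j) := by
    intro g hg j
    simp only [c, map_mul, map_star, hα g hg]
  have hc0 : ∀ k, φ (c k) = φ (c j) := by
    intro k
    have := swap_indep a α hα φ hφ c hcα (IsProdOver.one (a := a)) (j := j) (k := k)
      (by simp) (by simp)
    simpa using this
  let U : Ultrafilter ℕ := hyperfilter ℕ
  have hU : (U : Filter ℕ) ≤ atTop := by
    rw [← Nat.cofinite_eq_atTop]
    exact hyperfilter_le_cofinite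
  have hlim : ∀ y, ∃ z, Tendsto (fun k => φ (c k * y)) U (𝓝 z) := by
    intro y
    have hK := isCompact_closedBall (0 : ℂ) (C * ‖y‖)
    obtain ⟨z, -, hz⟩ := hK.ultrafilter_le_nhds (U.map fun k => φ (c k * y)) (by
      rw [le_principal_iff]
      refine Filter.mem_map.2 (Filter.univ_mem' fun k => ?_)
      simp only [Set.mem_preimage, mem_closedBall_zero_iff]
      refine (hb _).trans ?_
      gcongr
      refine (norm_mul_le _ _).trans ?_
      have := num_norm ha k
      have := norm_nonneg y
      simp only [c]
      nlinarith)
    exact ⟨z, hz⟩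
  choose L hL using hlim
  let ψ : A →ₗ[ℂ] ℂ :=
    { toFun := L
      map_add' := by
        intro x y
        refine tendsto_nhds_unique (hL (x + y)) (((hL x).add (hL y)).congr fun k => ?_)
        rw [mul_add, map_add]
      map_smul' := by
        intro r x
        refine tendsto_nhds_unique (hL (r • x)) (((hL x).const_mul r).congr fun k => ?_)
        rw [mul_smul_comm, map_smul, smul_eq_mul] }
  have hψ : ∀ y, Tendsto (fun k => φ (c k * y)) U (𝓝 (ψ y)) := hL
  -- value at one
  have hψ1 : ψ 1 = φ (c j) := by
    refine tendsto_nhds_unique (hψ 1) (tendsto_const_nhds.congr fun k => ?_)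
    rw [mul_one, hc0 k]
  -- the compressed version
  have hψ2 : ∀ y, Tendsto (fun k => φ (star y * c k * y)) U (𝓝 (ψ (star y * y))) := by
    intro y
    have h1 : Tendsto (fun k => φ ((c k * star y - star y * c k) * y)) U (𝓝 0) := by
      have hcont : Continuous φ :=
        AddMonoidHomClass.continuous_of_bound φ C hb
      have h2 := ((num_commute ha (star y)).mono_left hU).mul_const y
      have h3 := (hcont.tendsto _).comp h2
      simp only [zero_mul, map_zero] at h3
      exact h3
    have h4 := (hψ (star y * y)).sub h1
    rw [sub_zero] at h4
    refine h4.congr fun k => ?_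
    rw [← map_sub]
    congr 1
    noncomm_ring
  have hpos1 : ∀ y, 0 ≤ ψ (star y * y) := by
    intro y
    refine ge_of_tendsto (hψ2 y) (Filter.Eventually.of_forall fun k => ?_)
    have h1 := hφ.1.2 (c k * y)
    have h2 : star (c k * y) * (c k * y) = star y * c k * y := by
      rw [star_mul, show star (c k) = c k from num_star a k, mul_assoc, ← mul_assoc (c k),
        show c k * c k = c k from num_idem ha k, ← mul_assoc]
    rwa [h2] at h1
  have hpos2 : ∀ y, ψ (star y * y) ≤ φ (star y * y) := by
    intro y
    refine le_of_tendsto (hψ2 y) (Filter.Eventually.of_forall fun k => ?_)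
    have h1 := hφ.1.2 ((1 - c k) * y)
    have h2 : star ((1 - c k) * y) * ((1 - c k) * y) = star y * y - star y * c k * y := by
      have h3 : (1 - c k) * (1 - c k) = 1 - c k := by
        rw [sub_mul, mul_sub, mul_sub, show c k * c k = c k from num_idem ha k]; simp
      rw [star_mul, star_sub, star_one, show star (c k) = c k from num_star a k, mul_assoc,
        ← mul_assoc (1 - c k), h3]
      noncomm_ring
    rw [h2, map_sub, sub_nonneg] at h1
    exact h1
  have hsym : ∀ g : Equiv.Perm ℕ, IsFinitePerm g → ∀ x, ψ (α g x) = ψ x := by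
    intro g hg x
    refine tendsto_nhds_unique (hψ (α g x)) ((hψ x).congr' ?_)
    have hev : ∀ᶠ k in (U : Filter ℕ), g k = k := by
      apply hyperfilter_le_cofinite
      rw [mem_cofinite]
      exact hg
    filter_upwards [hev] with k hk
    rw [← hφ.2 g hg (c k * x), map_mul (α g), hcα g hg, hk]
  -- the two symmetric states
  set p : ℂ := φ (c j) with hp
  have hp0 : 0 ≤ p := by
    have := hpos1 1
    simpa [hψ1] using this
  have hp1 : p ≤ 1 := by
    have := hpos2 1
    simpa [hψ1, hφ.1.1] using this
  have hm1 : φ + (ψ - p • φ) ∈ SymmetricStates α := by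
    refine ⟨⟨?_, fun x => ?_⟩, fun g hg x => ?_⟩
    · simp [hψ1, hφ.1.1]
    · have h1 := hpos1 x
      have h2 := mul_nonneg (sub_nonneg.2 hp1) (hφ.1.2 x)
      have h3 := add_nonneg h1 h2
      convert h3 using 1
      simp only [LinearMap.add_apply, LinearMap.sub_apply, LinearMap.smul_apply, smul_eq_mul]
      ring
    · simp only [LinearMap.add_apply, LinearMap.sub_apply, LinearMap.smul_apply, hsym g hg,
        hφ.2 g hg]
  have hm2 : φ - (ψ - p • φ) ∈ SymmetricStates α := by
    refine ⟨⟨?_, fun x => ?_⟩, fun g hg x => ?_⟩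
    · simp [hψ1, hφ.1.1]
    · have h1 := sub_nonneg.2 (hpos2 x)
      have h2 := mul_nonneg hp0 (hφ.1.2 x)
      have h3 := add_nonneg h1 h2
      convert h3 using 1
      simp only [LinearMap.sub_apply, LinearMap.smul_apply, smul_eq_mul]
      ring
    · simp only [LinearMap.sub_apply, LinearMap.smul_apply, hsym g hg, hφ.2 g hg]
  have heq := hext _ hm1 _ hm2 ⟨1 / 2, 1 / 2, by norm_num, by norm_num, by norm_num, by module⟩
  have hψy : ψ y = p * φ y := by
    have := congrArg (fun f => f y) heq
    simp only [LinearMap.add_apply, LinearMap.sub_apply, LinearMap.smul_apply, smul_eq_mul] at this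
    linear_combination this
  rw [← hψy]
  refine tendsto_nhds_unique (tendsto_const_nhds.congr' ?_) (hψ y)
  have hev : ∀ᶠ k in (U : Filter ℕ), k ∉ S := by
    apply hyperfilter_le_cofinite
    rw [mem_cofinite]
    refine S.finite_toSet.subset fun k hk => ?_
    simpa using hk
  filter_upwards [hev] with k hk
  exact (swap_indep a α hα φ hφ c hcα hy hj hk).symm

theorem product_of_extreme (a : ℕ → A) (ha : IsCARFamily a)
    (α : Equiv.Perm ℕ → (A ≃⋆ₐ[ℂ] A))
    (hα : ∀ g : Equiv.Perm ℕ, IsFinitePerm g → ∀ j : ℕ, α g (a j) = a (g j))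
    (φ : A →ₗ[ℂ] ℂ) (hφ : φ ∈ Set.extremePoints ℝ (SymmetricStates α)) :
    IsProductState a φ := by
  have hs := extremePoints_subset hφ
  rw [isProductState_iff ha hs.1.1]
  intro S j x y hj hx hy
  obtain ⟨s, t, u, v, rfl⟩ := hx
  have hodd : ∀ {S : Finset ℕ} {y : A}, IsProdOver a S y → j ∉ S → φ (a j * y) = 0 := by
    intro S y hy hj
    refine odd_vanish a α hα φ hs a hα ?_ hy hj
    intro j k
    split_ifs with h
    · subst h; rw [add_comm]; exact ha.1 j
    · rw [add_comm]; exact ha.2.1 k j (Ne.symm h)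
  have hodd' : ∀ {S : Finset ℕ} {y : A}, IsProdOver a S y → j ∉ S → φ (star (a j) * y) = 0 := by
    intro S y hy hj
    refine odd_vanish a α hα φ hs (fun k => star (a k)) ?_ ?_ hy hj
    · intro g hg k
      rw [map_star, hα g hg]
    · intro j k
      rw [star_star]
      split_ifs with h
      · subst h; exact ha.1 j
      · exact ha.2.1 j k h
  have h1 := hodd hy hj
  have h2 := hodd' hy hj
  have h3 := hodd (IsProdOver.one (a := a)) (by simp)
  have h4 := hodd' (IsProdOver.one (a := a)) (by simp)
  rw [mul_one] at h3 h4
  have h5 := num_factor a ha α hα φ hφ hy hj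
  simp only [add_mul, smul_mul_assoc, one_mul, map_add, map_smul, smul_eq_mul, h1, h2, h3, h4, h5,
    hs.1.1]
  ring

end Helpers

/-- **De Finetti theorem for the CAR algebra, countable case.**
For a symmetric state `φ` on the CAR algebra over the positive integers, the following
are equivalent: (i) `φ` is an extreme point of the convex set of symmetric states;
(ii) `φ` is strongly clustering along Størmer's permutations `gswap n`;
(iii) `φ` is a product state. -/
theorem symmetric_state_extreme_iff_strongly_clustering_iff_product {A : Type*}
    [NormedRing A] [StarRing A] [CStarRing A] [NormedAlgebra ℂ A] [StarModule ℂ A]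
    [CompleteSpace A]
    (a : ℕ → A) (ha : IsCARFamily a)
    (α : Equiv.Perm ℕ → (A ≃⋆ₐ[ℂ] A))
    (hα : ∀ g : Equiv.Perm ℕ, IsFinitePerm g → ∀ j : ℕ, α g (a j) = a (g j))
    (φ : A →ₗ[ℂ] ℂ) (hφ : φ ∈ SymmetricStates α) :
    (φ ∈ Set.extremePoints ℝ (SymmetricStates α) ↔
      ∀ x y : A,
        Tendsto (fun n : ℕ => φ (α (gswap n) x * y)) atTop (𝓝 (φ x * φ y))) ∧
    (φ ∈ Set.extremePoints ℝ (SymmetricStates α) ↔ IsProductState a φ) := by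
  have h13 := product_of_extreme a ha α hα φ
  have h32 := clustering_of_product a ha α hα φ hφ
  have h21 := extreme_of_clustering_s9 α φ hφ
  exact ⟨⟨fun h => h32 (h13 h), h21⟩, ⟨h13, fun h => h21 (h32 h)⟩⟩
end
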